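/- There exists a holomorphic map φ : 𝔻 → ℂ² which is injective, is an immersion (φ'(ζ) ≠ 0 for every ζ ∈ 𝔻), has image contained in 𝔹₂, is proper as a map from 𝔻 into 𝔹₂, and is complete: for every divergent path γ : [0,1) → 𝔻 the path φ ∘ γ has infinite length. (Alarcón–Globevnik–López: a complete proper holomorphic embedding of the disc into the ball of ℂ².) -/

import Mathlib

open Set Metric
open scoped ENNReal

noncomputable section

/-- A path `γ : [0,1) → E` is a divergent path in the open set `Ω` if it is continuous on
`[0,1)`, takes values in `Ω`, and eventually leaves every compact subset of `Ω`. -/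
def DivergentPathIn {E : Type*} [TopologicalSpace E] (Ω : Set E) (γ : ℝ → E) : Prop :=
  ContinuousOn γ (Set.Ico 0 1) ∧
  (∀ t ∈ Set.Ico (0 : ℝ) 1, γ t ∈ Ω) ∧
  ∀ K : Set E, K ⊆ Ω → IsCompact K →
    ∃ t₀ ∈ Set.Ico (0 : ℝ) 1, ∀ t ∈ Set.Ico t₀ 1, γ t ∉ K

section Shear

lemma mem_connectedComponentIn_of_mem_closure {X : Type*} [TopologicalSpace X] {s : Set X}
    {x y : X} (hy : y ∈ closure (connectedComponentIn s x)) (hys : y ∈ s) :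
    y ∈ connectedComponentIn s x := by
  have hne : (connectedComponentIn s x).Nonempty := closure_nonempty_iff.1 ⟨y, hy⟩
  have hx : x ∈ connectedComponentIn s x :=
    mem_connectedComponentIn (connectedComponentIn_nonempty_iff.1 hne)
  have h1 : IsPreconnected (insert y (connectedComponentIn s x)) :=
    isPreconnected_connectedComponentIn.subset_closure (subset_insert _ _)
      (insert_subset hy subset_closure)
  exact h1.subset_connectedComponentIn (mem_insert_of_mem _ hx)
    (insert_subset hys (connectedComponentIn_subset _ _)) (mem_insert _ _)

lemma exists_sphere_lower_bound {p : ℂ → ℂ} (hp : Differentiable ℂ p) (hpc : ¬ ∃ c, ∀ z, p z = c)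
    (x : ℂ) {U : Set ℂ} (hU : U ∈ nhds x) :
    ∃ r > 0, ∃ ε > 0, closedBall x r ⊆ U ∧ ∀ z ∈ sphere x r, ε ≤ ‖p z - p x‖ := by
  have han : AnalyticAt ℂ p x := hp.analyticAt x
  rcases han.eventually_eq_or_eventually_ne (analyticAt_const (v := p x)) with h | h
  · exfalso
    apply hpc
    refine ⟨p x, fun z => ?_⟩
    have h1 : AnalyticOnNhd ℂ p univ := fun z _ => hp.analyticAt z
    exact h1.eqOn_of_preconnected_of_eventuallyEq analyticOnNhd_const isPreconnected_univ
      (mem_univ x) h (mem_univ z)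
  · rw [eventually_nhdsWithin_iff] at h
    obtain ⟨r, hr, hr'⟩ := Metric.nhds_basis_closedBall.mem_iff.1 (Filter.inter_mem h hU)
    have hc : ContinuousOn (fun z => ‖p z - p x‖) (sphere x r) :=
      (hp.continuous.sub continuous_const).norm.continuousOn
    obtain ⟨z0, hz0, hmin⟩ := (isCompact_sphere x r).exists_isMinOn
      (NormedSpace.sphere_nonempty.2 hr.le) hc
    refine ⟨r, hr, ‖p z0 - p x‖, ?_, fun z hz => (hr' hz).2, fun z hz => hmin hz⟩
    have h2 := (hr' (sphere_subset_closedBall hz0)).1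
    have : z0 ≠ x := by
      rintro rfl
      simp at hz0
      exact hr.ne hz0
    exact norm_pos_iff.2 (sub_ne_zero.2 (h2 this))

variable {H : Type*} [NormedAddCommGroup H] [InnerProductSpace ℂ H]

lemma re_mul_inner_bound {W v : H} {g : ℂ} {S T : ℝ} (hv : ‖v‖ = 1) (hW : ‖W‖ = S)
    (h : ‖W + g • v‖ < T) :
    2 * (g * inner ℂ W v).re + ‖g‖ ^ 2 < T ^ 2 - S ^ 2 := by
  have h1 : ‖W + g • v‖ ^ 2 < T ^ 2 := by gcongr
  have h2 := norm_add_sq (𝕜 := ℂ) W (g • v)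
  rw [inner_smul_right, norm_smul, hv, mul_one] at h2
  rw [hW] at h2
  have : (RCLike.re (g * inner ℂ W v) : ℝ) = (g * inner ℂ W v).re := rfl
  rw [this] at h2
  linarith

lemma cut_local {F : ℂ → H} (hF : Differentiable ℂ F) {p : ℂ → ℂ} (hp : Differentiable ℂ p)
    (hpc : ¬ ∃ c, ∀ z, p z = c) (a : ℂ) {v : H} (hv : ‖v‖ = 1) {R' S : ℝ} (hR' : 0 < R')
    (hS : R' < S) (h0 : ‖F 0‖ < R') {x : ℂ} (hx : ‖F x‖ = S) :
    ∃ U ∈ nhds x, ∀ᶠ N : ℝ in Filter.atTop, ∀ y ∈ U,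
      y ∉ connectedComponentIn {z | ‖F z + Complex.exp (N * (p z - a)) • v‖ < R'} 0 := by
  set m := (S - R') / 2 with hm
  have hmpos : 0 < m := by rw [hm]; linarith
  have hV : {z | ‖F z - F x‖ < m} ∈ nhds x := by
    apply (isOpen_lt (hF.continuous.sub continuous_const).norm continuous_const).mem_nhds
    simpa using hmpos
  obtain ⟨r, hr, ε, hε, hsub, hsph⟩ := exists_sphere_lower_bound hp hpc x hV
  set κ := S ^ 2 - (R' + m) ^ 2 with hκ
  have hκpos : 0 < κ := by
    have : R' + m < S := by rw [hm]; linarith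
    have : (R' + m) ^ 2 < S ^ 2 := by gcongr
    linarith
  have hSpos : 0 < S := hR'.trans hS
  set L := Real.log (2 * S / (κ / (2 * S))) with hL
  refine ⟨ball x r ∩ {y | ‖p y - p x‖ < ε / 2}, Filter.inter_mem (ball_mem_nhds x hr) ?_, ?_⟩
  · apply (isOpen_lt (hp.continuous.sub continuous_const).norm continuous_const).mem_nhds
    simpa using hε
  filter_upwards [Filter.eventually_gt_atTop ((L + Real.pi) / (ε / 2)),
    Filter.eventually_gt_atTop 0] with N hN hN0
  rintro y ⟨hy1, hy2⟩ hyB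
  set g : ℂ → ℂ := fun z => Complex.exp (N * (p z - a)) with hg
  set A := {z | ‖F z + Complex.exp (N * (p z - a)) • v‖ < R'} with hA
  set b : ℂ := inner ℂ (F x) v with hb
  have hbS : ‖b‖ ≤ S := by
    have := norm_inner_le_norm (𝕜 := ℂ) (F x) v
    rwa [hv, hx, mul_one] at this
  have h0A : (0 : ℂ) ∈ connectedComponentIn A 0 :=
    mem_connectedComponentIn (connectedComponentIn_nonempty_iff.1 ⟨y, hyB⟩)
  -- the basic estimates on the part of the component close to `x`
  have key : ∀ z ∈ connectedComponentIn A 0, z ∈ closedBall x r →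
      (g z * b).re < 0 ∧ κ / (2 * S) ≤ ‖g z‖ ∧ ‖g z‖ ≤ 2 * S := by
    intro z hz hzr
    have hz0 : z ∈ A := connectedComponentIn_subset _ _ hz
    have hz1 : ‖F z + g z • v‖ < R' := hz0
    have hz2 : ‖F z - F x‖ < m := hsub hzr
    have hz3 : ‖F x + g z • v‖ < R' + m := by
      have : F x + g z • v = (F z + g z • v) - (F z - F x) := by abel
      rw [this]
      exact (norm_sub_le _ _).trans_lt (by linarith)
    have h1 := re_mul_inner_bound hv hx hz3
    have h2 : |(g z * b).re| ≤ ‖g z‖ * S := by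
      refine (Complex.abs_re_le_norm _).trans ?_
      rw [norm_mul]; gcongr
    have h3 := neg_abs_le (g z * b).re
    refine ⟨by nlinarith [sq_nonneg ‖g z‖], ?_, ?_⟩
    · rw [div_le_iff₀ (by positivity)]
      nlinarith [sq_nonneg ‖g z‖]
    · by_contra! hc
      nlinarith [norm_nonneg (g z)]
  have hyr : y ∈ closedBall x r := ball_subset_closedBall hy1
  obtain ⟨ky1, ky2, ky3⟩ := key y hyB hyr
  have hgz : ∀ z w, g z = Complex.exp (N * (p z - p w)) * g w := by
    intro z w
    simp only [hg, ← Complex.exp_add]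
    congr 1; ring
  have hre : ∀ z w, z ∈ connectedComponentIn A 0 → z ∈ closedBall x r →
      w ∈ connectedComponentIn A 0 → w ∈ closedBall x r → N * ((p z).re - (p w).re) ≤ L := by
    intro z w hz hzr hw hwr
    obtain ⟨-, -, kz⟩ := key z hz hzr
    obtain ⟨-, kw, -⟩ := key w hw hwr
    rw [hL, Real.le_log_iff_exp_le (by positivity), le_div_iff₀ (by positivity)]
    rw [hgz z w, norm_mul, Complex.norm_exp] at kz
    have : ((N : ℂ) * (p z - p w)).re = N * ((p z).re - (p w).re) := by simp
    rw [this] at kz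
    refine le_trans ?_ kz
    gcongr
  have him : ∀ z, z ∈ connectedComponentIn A 0 → z ∈ closedBall x r →
      N * |(p z).im - (p y).im| ≠ Real.pi := by
    intro z hz hzr h
    obtain ⟨kz, -, -⟩ := key z hz hzr
    have h1 : |N * ((p z).im - (p y).im)| = Real.pi := by
      rw [abs_mul, abs_of_pos hN0, h]
    have h2 : Complex.exp (N * (p z - p y))
        = (-(Real.exp (N * ((p z).re - (p y).re))) : ℝ) := by
      have hd : (N : ℂ) * (p z - p y)
        = (N * ((p z).re - (p y).re) : ℝ) + (N * ((p z).im - (p y).im) : ℝ) * Complex.I := by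
        apply Complex.ext <;> simp
      rw [hd, Complex.exp_add]
      rcases (abs_eq Real.pi_pos.le).1 h1 with h3 | h3
      · rw [h3, Complex.exp_pi_mul_I]; push_cast; ring
      · rw [h3]; push_cast; rw [neg_mul, Complex.exp_neg, Complex.exp_pi_mul_I]; norm_num
    rw [hgz z y, h2, mul_assoc, Complex.re_ofReal_mul] at kz
    nlinarith [Real.exp_pos (N * ((p z).re - (p y).re))]
  set Y := ball x r ∩ {z | N * |(p z).im - (p y).im| < Real.pi} with hY
  have himc : Continuous fun z => N * |(p z).im - (p y).im| :=
    continuous_const.mul ((Complex.continuous_im.comp hp.continuous).sub continuous_const).abs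
  have hYo : IsOpen Y := isOpen_ball.inter (isOpen_lt himc continuous_const)
  have hYc : closure Y ⊆ closedBall x r ∩ {z | N * |(p z).im - (p y).im| ≤ Real.pi} := by
    apply closure_minimal
    · exact inter_subset_inter ball_subset_closedBall (fun z hz => by
        simp only [mem_ofPred_eq] at hz ⊢; exact hz.le)
    · exact isClosed_closedBall.inter (isClosed_le himc continuous_const)
  have hsubY : connectedComponentIn A 0 ⊆ Y := by
    apply isPreconnected_connectedComponentIn.subset_of_closure_inter_subset hYo
    · exact ⟨y, hyB, hy1, by simp [Real.pi_pos]⟩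
    rintro z ⟨hz1, hz2⟩
    obtain ⟨hzr, hzi⟩ := hYc hz1
    have hzi' : N * |(p z).im - (p y).im| < Real.pi := lt_of_le_of_ne hzi (him z hz2 hzr)
    refine ⟨?_, hzi'⟩
    by_contra hzb
    have hzs : z ∈ sphere x r := by
      rw [mem_sphere]; rw [mem_ball, not_lt] at hzb; exact le_antisymm hzr hzb
    have e1 := hsph z hzs
    have e2 : ‖p z - p x‖ ≤ ‖p z - p y‖ + ‖p y - p x‖ := norm_sub_le_norm_sub_add_norm_sub _ _ _
    have e3 : ‖p z - p y‖ ≤ |(p z - p y).re| + |(p z - p y).im| := Complex.norm_le_abs_re_add_abs_im _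
    have e4 : N * |(p z - p y).re| ≤ L := by
      rw [show N * |(p z - p y).re| = |N * (p z - p y).re| by rw [abs_mul, abs_of_pos hN0], abs_le]
      have := hre z y hz2 hzr hyB hyr
      have := hre y z hyB hyr hz2 hzr
      constructor <;> simp <;> linarith
    have e5 : N * |(p z - p y).im| < Real.pi := by simpa using hzi'
    have e6 : ‖p y - p x‖ < ε / 2 := hy2
    rw [div_lt_iff₀ (by positivity)] at hN
    have e7 : ε / 2 < |(p z - p y).re| + |(p z - p y).im| := by linarith
    nlinarith
  have h0Y : ‖F 0 - F x‖ < m := hsub (ball_subset_closedBall (hsubY h0A).1)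
  have := norm_sub_norm_le (F x) (F 0)
  rw [norm_sub_rev] at this
  rw [hx] at this
  linarith

lemma component_subset_of_perturb {F : ℂ → H} (hF : Differentiable ℂ F) {p : ℂ → ℂ}
    (hp : Differentiable ℂ p) (hpc : ¬ ∃ c, ∀ z, p z = c) (a : ℂ) {v : H} (hv : ‖v‖ = 1)
    {R R' : ℝ} (hR' : 0 < R') (hRR : R' < R) (h0 : ‖F 0‖ < R')
    (hB : Bornology.IsBounded (connectedComponentIn {z | ‖F z‖ < R} 0)) :
    ∀ᶠ N : ℝ in Filter.atTop,
      connectedComponentIn {z | ‖F z + Complex.exp (N * (p z - a)) • v‖ < R'} 0 ⊆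
        connectedComponentIn {z | ‖F z‖ < R} 0 := by
  set B := connectedComponentIn {z | ‖F z‖ < R} 0 with hBdef
  set S := (R + R') / 2 with hS
  have hS1 : R' < S := by rw [hS]; linarith
  have hS2 : S < R := by rw [hS]; linarith
  have hBo : IsOpen B := (isOpen_lt hF.continuous.norm continuous_const).connectedComponentIn
  set K := closure B ∩ {z | ‖F z‖ = S} with hK
  have hKc : IsCompact K := hB.isCompact_closure.inter_right
    (isClosed_eq hF.continuous.norm continuous_const)
  have hKN : ∀ᶠ N : ℝ in Filter.atTop, ∀ y ∈ K,
      y ∉ connectedComponentIn {z | ‖F z + Complex.exp (N * (p z - a)) • v‖ < R'} 0 := by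
    refine hKc.induction_on (p := fun s => ∀ᶠ N : ℝ in Filter.atTop, ∀ y ∈ s,
      y ∉ connectedComponentIn {z | ‖F z + Complex.exp (N * (p z - a)) • v‖ < R'} 0)
      (by simp) ?_ ?_ ?_
    · intro s t hst ht
      filter_upwards [ht] with N hN y hy using hN y (hst hy)
    · intro s t hs ht
      filter_upwards [hs, ht] with N h1 h2 y hy
      exact hy.elim (h1 y) (h2 y)
    · intro x hx
      obtain ⟨U, hU, h⟩ := cut_local hF hp hpc a hv hR' hS1 h0 hx.2
      exact ⟨U, mem_nhdsWithin_of_mem_nhds hU, h⟩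
  filter_upwards [hKN] with N hN
  set B' := connectedComponentIn {z | ‖F z + Complex.exp (N * (p z - a)) • v‖ < R'} 0 with hB'
  rcases B'.eq_empty_or_nonempty with he | hne
  · rw [he]; exact empty_subset _
  have h0B' : (0 : ℂ) ∈ B' := mem_connectedComponentIn (connectedComponentIn_nonempty_iff.1 hne)
  have h0B : (0 : ℂ) ∈ B := mem_connectedComponentIn (by
    show ‖F 0‖ < R
    linarith)
  have hsub : B' ⊆ B ∩ {z | ‖F z‖ < S} := by
    apply isPreconnected_connectedComponentIn.subset_of_closure_inter_subset
    · exact hBo.inter (isOpen_lt hF.continuous.norm continuous_const)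
    · exact ⟨0, h0B', h0B, by show ‖F 0‖ < S; linarith⟩
    rintro z ⟨hz1, hz2⟩
    have hzc : z ∈ closure B := closure_mono inter_subset_left hz1
    have hzS : ‖F z‖ ≤ S := by
      have : closure (B ∩ {z | ‖F z‖ < S}) ⊆ {z | ‖F z‖ ≤ S} :=
        closure_minimal (fun z hz => by
          have := hz.2
          simp only [mem_ofPred_eq] at this ⊢; exact this.le) (isClosed_le hF.continuous.norm continuous_const)
      exact this hz1
    have hzS' : ‖F z‖ < S := lt_of_le_of_ne hzS fun h => hN z ⟨hzc, h⟩ hz2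
    exact ⟨mem_connectedComponentIn_of_mem_closure hzc (by show ‖F z‖ < R; linarith), hzS'⟩
  exact hsub.trans inter_subset_left

lemma hasDerivAt_inner_left {F : ℂ → H} {F' : H} {z : ℂ} (u : H) (hF : HasDerivAt F F' z) :
    HasDerivAt (fun z => inner ℂ u (F z)) (inner ℂ u F') z :=
  ((innerSL ℂ u).hasFDerivAt.comp_hasDerivAt z hF)

lemma exists_shear_step {F : ℂ → H} (hF : Differentiable ℂ F) (hinj : Function.Injective F)
    (hder : ∀ z, deriv F z ≠ 0) {R R' : ℝ} (hR' : 0 < R') (hRR : R' < R) (h0 : ‖F 0‖ < R')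
    (hB : Bornology.IsBounded (connectedComponentIn {z | ‖F z‖ < R} 0))
    {u v : H} (hu : ‖u‖ = 1) (hv : ‖v‖ = 1) (huv : inner ℂ u v = 0) {ρ η ε : ℝ}
    (hη : 0 < η) (hε : 0 < ε) (h0ρ : (inner ℂ u (F 0)).re ≤ ρ - η) :
    ∃ F' : ℂ → H, Differentiable ℂ F' ∧ Function.Injective F' ∧ (∀ z, deriv F' z ≠ 0) ∧
      connectedComponentIn {z | ‖F' z‖ < R'} 0 ⊆ connectedComponentIn {z | ‖F z‖ < R} 0 ∧
      (∀ z, inner ℂ u (F' z) = inner ℂ u (F z)) ∧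
      (∀ z, (inner ℂ u (F z)).re ≤ ρ - η → ‖F' z - F z‖ ≤ ε) ∧
      (∀ z w, (inner ℂ u (F z)).re ≤ ρ - η → (inner ℂ u (F w)).re ≤ ρ - η →
        ‖(F' z - F z) - (F' w - F w)‖ ≤ ε * ‖F z - F w‖) ∧
      ∀ z ∈ connectedComponentIn {z | ‖F' z‖ < R'} 0, (inner ℂ u (F' z)).re < ρ := by
  set p : ℂ → ℂ := fun z => inner ℂ u (F z) with hp
  have hpd : ∀ z, HasDerivAt p (inner ℂ u (deriv F z)) z := fun z =>
    hasDerivAt_inner_left u (hF z).hasDerivAt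
  have hpdiff : Differentiable ℂ p := fun z => (hpd z).differentiableAt
  set a : ℂ := ((ρ - η / 2 : ℝ) : ℂ) with ha
  have hg1 : ∀ N s, ‖Complex.exp ((N : ℝ) * (s - a))‖ = Real.exp (N * (s.re - (ρ - η / 2))) := by
    intro N s
    rw [Complex.norm_exp]
    simp [ha]
  have hlim : Filter.Tendsto (fun N : ℝ => Real.exp (-(N * (η / 2)))) Filter.atTop (nhds 0) :=
    Real.tendsto_exp_neg_atTop_nhds_zero.comp
      (Filter.tendsto_id.atTop_mul_const (by positivity : 0 < η / 2))
  have hlim2 : Filter.Tendsto (fun N : ℝ => N * Real.exp (-(N * (η / 2)))) Filter.atTop (nhds 0) := by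
    have h1 := (Real.tendsto_pow_mul_exp_neg_atTop_nhds_zero 1).comp
      (Filter.tendsto_id.atTop_mul_const (by positivity : 0 < η / 2))
    have h2 := h1.mul_const (2 / η)
    rw [zero_mul] at h2
    refine h2.congr fun N => ?_
    simp only [Function.comp, id, pow_one]
    field_simp
  have hsub : ∀ᶠ N : ℝ in Filter.atTop,
      connectedComponentIn {z | ‖F z + Complex.exp (N * (p z - a)) • v‖ < R'} 0 ⊆
        connectedComponentIn {z | ‖F z‖ < R} 0 := by
    by_cases hpc : ∃ c, ∀ z, p z = c
    · obtain ⟨c, hc⟩ := hpc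
      filter_upwards [hlim.eventually_lt_const (sub_pos.2 hRR), Filter.eventually_gt_atTop 0]
        with N hN hN0
      apply connectedComponentIn_mono
      intro z hz
      simp only [mem_ofPred_eq] at hz ⊢
      have h1 : ‖Complex.exp (N * (p z - a)) • v‖ ≤ Real.exp (-(N * (η / 2))) := by
        rw [norm_smul, hv, mul_one, hg1]
        apply Real.exp_le_exp.2
        have : (p z).re ≤ ρ - η := by rw [hc z, ← hc 0]; exact h0ρ
        nlinarith
      have h2 := norm_sub_le (F z + Complex.exp (N * (p z - a)) • v) (Complex.exp (N * (p z - a)) • v)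
      rw [add_sub_cancel_right] at h2
      linarith
    · exact component_subset_of_perturb hF hpdiff hpc a hv hR' hRR h0 hB
  obtain ⟨N, hNsub, hNε, hNε2, hNR, hN0⟩ := (hsub.and ((hlim.eventually_lt_const hε).and
    ((hlim2.eventually_lt_const hε).and
    ((hlim.eventually_lt_const (u := 1 / (2 * R)) (by have := hR'.trans hRR; positivity)).and
    (Filter.eventually_gt_atTop 0))))).exists
  set g : ℂ → ℂ := fun z => Complex.exp (N * (p z - a)) with hg
  have hgd : ∀ z, HasDerivAt g (g z * (N * inner ℂ u (deriv F z))) z := fun z =>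
    (((hpd z).sub_const a).const_mul (N : ℂ)).cexp
  have hFd : ∀ z, HasDerivAt (fun z => F z + g z • v)
      (deriv F z + (g z * (N * inner ℂ u (deriv F z))) • v) z := fun z =>
    (hF z).hasDerivAt.add ((hgd z).smul_const v)
  have hpres : ∀ z, inner ℂ u (F z + g z • v) = p z := by
    intro z; rw [inner_add_right, inner_smul_right, huv, mul_zero, add_zero]
  refine ⟨fun z => F z + g z • v, fun z => (hFd z).differentiableAt, ?_, ?_, hNsub, hpres, ?_, ?_, ?_⟩
  · intro z w hzw
    simp only at hzw
    have h1 : p z = p w := by rw [← hpres z, ← hpres w, hzw]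
    have h2 : g z = g w := by simp only [hg, h1]
    rw [h2] at hzw
    exact hinj (add_right_cancel hzw)
  · intro z hz
    rw [(hFd z).deriv] at hz
    have h1 : inner ℂ u (deriv F z) = (0 : ℂ) := by
      have := congrArg (inner ℂ u) hz
      rwa [inner_add_right, inner_smul_right, huv, mul_zero, add_zero, inner_zero_right] at this
    rw [h1, mul_zero, mul_zero, zero_smul, add_zero] at hz
    exact hder z hz
  · intro z hz
    rw [add_sub_cancel_left, norm_smul, hv, mul_one, hg1]
    refine le_trans (Real.exp_le_exp.2 ?_) hNε.le
    nlinarith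
  · intro z w hz hw
    rw [add_sub_cancel_left, add_sub_cancel_left, ← sub_smul, norm_smul, hv, mul_one]
    have hconv : Convex ℝ {s : ℂ | s.re ≤ ρ - η} := convex_halfSpace_re_le _
    have h1 := Convex.norm_image_sub_le_of_norm_hasDerivWithin_le
      (f := fun s : ℂ => Complex.exp (N * (s - a)))
      (f' := fun s : ℂ => Complex.exp (N * (s - a)) * (N * 1)) (C := ε) (s := {s : ℂ | s.re ≤ ρ - η})
      (x := p w) (y := p z)
      (fun s _ => ((((hasDerivAt_id s).sub_const a).const_mul (N : ℂ)).cexp).hasDerivWithinAt)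
      (fun s hs => by
        simp only [mem_ofPred_eq] at hs
        rw [norm_mul, hg1, mul_one, Complex.norm_real, Real.norm_of_nonneg hN0.le, mul_comm]
        refine le_trans (b := N * Real.exp (-(N * (η / 2)))) ?_ hNε2.le
        gcongr
        nlinarith) hconv hw hz
    refine h1.trans ?_
    gcongr
    have h2 := norm_inner_le_norm (𝕜 := ℂ) u (F z - F w)
    rwa [hu, one_mul, inner_sub_right] at h2
  · intro z hz
    rw [hpres]
    by_contra! hc
    have h1 : ‖F z‖ < R := connectedComponentIn_subset {z | ‖F z‖ < R} 0 (hNsub hz)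
    have h2 : ‖F z + g z • v‖ < R' :=
      connectedComponentIn_subset {z | ‖F z + g z • v‖ < R'} 0 hz
    have h3 : Real.exp (N * (η / 2)) ≤ ‖g z • v‖ := by
      rw [norm_smul, hv, mul_one, hg1]
      apply Real.exp_le_exp.2
      nlinarith
    have h4 := norm_sub_le (F z + g z • v) (F z)
    rw [add_sub_cancel_left] at h4
    rw [Real.exp_neg, inv_eq_one_div, one_div_lt_one_div (Real.exp_pos _)
      (by have := hR'.trans hRR; positivity)] at hNR
    linarith

end Shear

/-- A bounded plane domain containing `0`, exhausted by relatively compact domains, without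
holes. -/
structure ExhaustedDomain (D : Set ℂ) (V : ℕ → Set ℂ) : Prop where
  bounded : Bornology.IsBounded D
  isOpen : ∀ n, IsOpen (V n)
  preconnected : ∀ n, IsPreconnected (V n)
  mono : Monotone V
  zero_mem : ∀ n, (0 : ℂ) ∈ V n
  iUnion : ⋃ n, V n = D
  closure_subset : ∀ n, closure (V n) ⊆ D
  fill : ∀ O : Set ℂ, IsOpen O → Bornology.IsBounded O → frontier O ⊆ D → O ⊆ D

/-- A sequence of walls `T k`, with supporting half-spaces, ordered so that a wall lies strictly
inside all later half-spaces. -/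
structure IsWallSequence {H : Type*} [NormedAddCommGroup H] [InnerProductSpace ℂ H]
    (u : ℕ → H) (σ η s : ℕ → ℝ) (T : ℕ → Set H) : Prop where
  norm_u : ∀ k, ‖u k‖ = 1
  η_pos : ∀ k, 0 < η k
  le_of_mem : ∀ k, ∀ z ∈ T k, σ k ≤ (inner ℂ (u k) z).re
  le_of_mem_of_lt : ∀ j k, j < k → ∀ z ∈ T j, (inner ℂ (u k) z).re ≤ σ k - 3 * η k
  s_mono : Monotone s
  half_le : 1 / 2 ≤ s 0
  s_lt : ∀ k, s k < 1
  s_tendsto : Filter.Tendsto s Filter.atTop (nhds 1)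
  s_le : ∀ k, s k ≤ σ k - 2 * η k

lemma exists_seq_of_step {α : Type*} (P : ℕ → α → Prop) (Q : ℕ → α → α → Prop) (a : α)
    (ha : P 0 a) (h : ∀ n x, P n x → ∃ y, P (n + 1) y ∧ Q n x y) :
    ∃ f : ℕ → α, f 0 = a ∧ (∀ n, P n (f n)) ∧ ∀ n, Q n (f n) (f (n + 1)) := by
  choose! g hg using h
  let f : ℕ → α := fun n => Nat.rec a g n
  have hP : ∀ n, P n (f n) := by
    intro n
    induction n with
    | zero => exact ha
    | succ n ih => exact (hg n _ ih).1
  exact ⟨f, rfl, hP, fun n => (hg n _ (hP n)).2⟩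

lemma exists_tail_seq {η : ℕ → ℝ} (hη : ∀ k, 0 < η k) :
    ∃ τ : ℕ → ℝ, τ 0 = 1 / 8 ∧ (∀ k, 0 < τ k) ∧ (∀ k, τ (k + 1) < τ k) ∧ (∀ k, τ (k + 1) ≤ η k) ∧
      Filter.Tendsto τ Filter.atTop (nhds 0) := by
  obtain ⟨τ, h0, hpos, hrec⟩ := exists_seq_of_step (fun _ t : _ => (0 : ℝ) < t)
    (fun k t t' => t' ≤ t / 2 ∧ t' ≤ η k) (1 / 8) (by norm_num) (fun k t ht =>
      ⟨min (t / 2) (η k), lt_min (by positivity) (hη k), min_le_left _ _, min_le_right _ _⟩)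
  refine ⟨τ, h0, hpos, fun k => ?_, fun k => (hrec k).2, ?_⟩
  · have := (hrec k).1; have := hpos k; linarith
  · have hb : ∀ k, τ k ≤ (1 / 8) * (1 / 2) ^ k := by
      intro k
      induction k with
      | zero => simp [h0]
      | succ k ih => rw [pow_succ]; have := (hrec k).1; linarith
    refine squeeze_zero (fun k => (hpos k).le) hb ?_
    simpa using (tendsto_pow_atTop_nhds_zero_of_lt_one (by norm_num : (0 : ℝ) ≤ 1 / 2)
      (by norm_num)).const_mul (1 / 8 : ℝ)

lemma exists_unit_orthogonal (u : EuclideanSpace ℂ (Fin 2)) (hu : ‖u‖ = 1) :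
    ∃ v : EuclideanSpace ℂ (Fin 2), ‖v‖ = 1 ∧ inner ℂ u v = 0 := by
  refine ⟨!₂[-(starRingEnd ℂ) (u 1), (starRingEnd ℂ) (u 0)], ?_, ?_⟩
  · rw [EuclideanSpace.norm_eq] at hu ⊢
    rw [← hu]
    simp [Fin.sum_univ_two, add_comm]
  · simp [PiLp.inner_apply, Fin.sum_univ_two]
    ring

abbrev H2 := EuclideanSpace ℂ (Fin 2)

/-- The sequence of shears avoiding successive walls. -/
structure IsShearSequence (u : ℕ → H2) (σ η τ : ℕ → ℝ) (F : ℕ → ℂ → H2) : Prop where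
  differentiable : ∀ k, Differentiable ℂ (F k)
  injective : ∀ k, Function.Injective (F k)
  deriv_ne : ∀ k z, deriv (F k) z ≠ 0
  norm_zero : ∀ k, ‖F k 0‖ ≤ τ 0 - τ k
  bounded : Bornology.IsBounded (connectedComponentIn {z | ‖F 0 z‖ < 2} 0)
  component : ∀ k : ℕ, connectedComponentIn {z | ‖F (k + 1) z‖ < 1 + 1 / ((k + 1 : ℕ) + 1 : ℝ)} 0 ⊆
    connectedComponentIn {z | ‖F k z‖ < 1 + 1 / (k + 1 : ℝ)} 0
  inner_eq : ∀ k z, inner ℂ (u k) (F (k + 1) z) = inner ℂ (u k) (F k z)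
  dist_lt : ∀ k z, (inner ℂ (u k) (F k z)).re ≤ σ k - 2 * η k →
    ‖F (k + 1) z - F k z‖ < τ k - τ (k + 1)
  dist_sub_le : ∀ k z w, (inner ℂ (u k) (F k z)).re ≤ σ k - 2 * η k →
    (inner ℂ (u k) (F k w)).re ≤ σ k - 2 * η k →
    ‖(F (k + 1) z - F k z) - (F (k + 1) w - F k w)‖ ≤ (τ k - τ (k + 1)) * ‖F k z - F k w‖
  re_lt : ∀ k : ℕ, ∀ z ∈ connectedComponentIn
    {z | ‖F (k + 1) z‖ < 1 + 1 / ((k + 1 : ℕ) + 1 : ℝ)} 0,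
    (inner ℂ (u k) (F (k + 1) z)).re < σ k - η k

lemma re_inner_le_norm_of_unit {u : H2} (hu : ‖u‖ = 1) (z : H2) : (inner ℂ u z).re ≤ ‖z‖ := by
  have h := norm_inner_le_norm (𝕜 := ℂ) u z
  rw [hu, one_mul] at h
  exact (Complex.re_le_norm _).trans h

lemma exists_shear_sequence {u : ℕ → H2} {σ η s τ : ℕ → ℝ} {T : ℕ → Set H2}
    (hw : IsWallSequence u σ η s T) (h0 : τ 0 = 1 / 8) (hpos : ∀ k, 0 < τ k)
    (hlt : ∀ k, τ (k + 1) < τ k) : ∃ F, IsShearSequence u σ η τ F := by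
  have hnorm : ∀ z : ℂ, ‖(!₂[z, 0] : H2)‖ = ‖z‖ := fun z => by
    simp [EuclideanSpace.norm_eq, Fin.sum_univ_two]
  have hd0 : ∀ z : ℂ, HasDerivAt (fun z : ℂ => (!₂[z, 0] : H2)) !₂[1, 0] z := fun z => by
    have e : (fun z : ℂ => (!₂[z, 0] : H2)) = fun z => z • !₂[1, 0] := by
      funext z; ext i; fin_cases i <;> simp
    rw [e]
    simpa using (hasDerivAt_id z).smul_const (!₂[1, 0] : H2)
  have hbd : Bornology.IsBounded (connectedComponentIn {z : ℂ | ‖(!₂[z, 0] : H2)‖ < 2} 0) := by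
    refine (isBounded_ball (x := (0 : ℂ)) (r := 2)).subset ((connectedComponentIn_subset _ _).trans ?_)
    intro z hz
    simpa [hnorm] using hz
  refine Exists.elim (exists_seq_of_step
    (fun k (F : ℂ → H2) => Differentiable ℂ F ∧ Function.Injective F ∧ (∀ z, deriv F z ≠ 0) ∧
      ‖F 0‖ ≤ τ 0 - τ k ∧
      Bornology.IsBounded (connectedComponentIn {z | ‖F z‖ < 1 + 1 / (k + 1 : ℝ)} 0))
    (fun k F F' => connectedComponentIn {z | ‖F' z‖ < 1 + 1 / ((k + 1 : ℕ) + 1 : ℝ)} 0 ⊆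
        connectedComponentIn {z | ‖F z‖ < 1 + 1 / (k + 1 : ℝ)} 0 ∧
      (∀ z, inner ℂ (u k) (F' z) = inner ℂ (u k) (F z)) ∧
      (∀ z, (inner ℂ (u k) (F z)).re ≤ σ k - 2 * η k → ‖F' z - F z‖ < τ k - τ (k + 1)) ∧
      (∀ z w, (inner ℂ (u k) (F z)).re ≤ σ k - 2 * η k →
        (inner ℂ (u k) (F w)).re ≤ σ k - 2 * η k →
        ‖(F' z - F z) - (F' w - F w)‖ ≤ (τ k - τ (k + 1)) * ‖F z - F w‖) ∧
      ∀ z ∈ connectedComponentIn {z | ‖F' z‖ < 1 + 1 / ((k + 1 : ℕ) + 1 : ℝ)} 0,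
        (inner ℂ (u k) (F' z)).re < σ k - η k)
    (fun z => !₂[z, 0]) ?_ ?_) ?_
  · refine ⟨fun z => (hd0 z).differentiableAt, ?_, ?_, ?_, ?_⟩
    · intro z w h
      simpa using congrArg (fun x : H2 => x 0) h
    · intro z h
      rw [(hd0 z).deriv] at h
      simpa using congrArg (fun x : H2 => x 0) h
    · rw [hnorm]; simp
    · have : (1 + 1 / ((0 : ℕ) + 1 : ℝ)) = 2 := by norm_num
      rw [this]; exact hbd
  · rintro k F ⟨hF, hinj, hder, hz, hB⟩
    obtain ⟨v, hv, huv⟩ := exists_unit_orthogonal (u k) (hw.norm_u k)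
    have hk1 : (0 : ℝ) < 1 / ((k + 1 : ℕ) + 1 : ℝ) := by positivity
    have hk2 : (1 : ℝ) / ((k + 1 : ℕ) + 1 : ℝ) < 1 / (k + 1 : ℝ) := by
      apply one_div_lt_one_div_of_lt (by positivity)
      push_cast; linarith
    have hs : 1 / 2 ≤ s k := hw.half_le.trans (hw.s_mono (Nat.zero_le k))
    have hre := re_inner_le_norm_of_unit (hw.norm_u k) (F 0)
    have hτ := hpos k
    have hsk := hw.s_le k
    have hre0 : (inner ℂ (u k) (F 0)).re ≤ σ k - 2 * η k := by linarith
    have hε := hlt k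
    obtain ⟨F', h1, h2, h3, h4, h5, h6, h7, h8⟩ := exists_shear_step hF hinj hder
      (R' := 1 + 1 / ((k + 1 : ℕ) + 1 : ℝ)) (by positivity) (by linarith) (by linarith) hB
      (hw.norm_u k) hv huv (ρ := σ k - η k) (η := η k) (ε := (τ k - τ (k + 1)) / 2) (hw.η_pos k)
      (by linarith) (by linarith)
    have e : σ k - η k - η k = σ k - 2 * η k := by ring
    rw [e] at h6 h7
    refine ⟨F', ⟨h1, h2, h3, ?_, hB.subset h4⟩, h4, h5, fun z hz => ?_, fun z w hz hw => ?_, h8⟩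
    · have := h6 0 hre0
      have h9 := norm_le_norm_add_norm_sub' (F' 0) (F 0)
      linarith
    · have := h6 z hz
      linarith
    · refine (h7 z w hz hw).trans ?_
      gcongr
      linarith
  · rintro F ⟨hF0, hP, hQ⟩
    refine ⟨F, fun k => (hP k).1, fun k => (hP k).2.1, fun k => (hP k).2.2.1,
      fun k => (hP k).2.2.2.1, ?_, fun k => (hQ k).1, fun k => (hQ k).2.1, fun k => (hQ k).2.2.1,
      fun k => (hQ k).2.2.2.1, fun k => (hQ k).2.2.2.2⟩
    rw [hF0]; exact hbd

/-- Sublevel sets on which a shear sequence converges uniformly. -/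
def sublevel (F : ℕ → ℂ → H2) (s τ : ℕ → ℝ) (k : ℕ) : Set ℂ := {z | ‖F k z‖ < s k - τ k}

/-- The data of a wall sequence, an error sequence and an adapted shear sequence. -/
structure ShearData (u : ℕ → H2) (σ η s τ : ℕ → ℝ) (T : ℕ → Set H2) (F : ℕ → ℂ → H2) : Prop
    extends IsWallSequence u σ η s T, IsShearSequence u σ η τ F where
  τ_zero : τ 0 = 1 / 8
  τ_pos : ∀ k, 0 < τ k
  τ_lt : ∀ k, τ (k + 1) < τ k
  τ_le : ∀ k, τ (k + 1) ≤ η k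
  τ_tendsto : Filter.Tendsto τ Filter.atTop (nhds 0)

namespace ShearData

variable {u : ℕ → H2} {σ η s τ : ℕ → ℝ} {T : ℕ → Set H2} {F : ℕ → ℂ → H2}

lemma τ_antitone (h : ShearData u σ η s τ T F) : Antitone τ :=
  antitone_nat_of_succ_le fun k => (h.τ_lt k).le

lemma re_le (h : ShearData u σ η s τ T F) {k : ℕ} {z : ℂ} (hz : ‖F k z‖ ≤ s k) :
    (inner ℂ (u k) (F k z)).re ≤ σ k - 2 * η k :=
  (re_inner_le_norm_of_unit (h.norm_u k) _).trans (hz.trans (h.s_le k))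

lemma re_le_of_mem (h : ShearData u σ η s τ T F) {k : ℕ} {z : ℂ} (hz : z ∈ sublevel F s τ k) :
    (inner ℂ (u k) (F k z)).re ≤ σ k - 2 * η k := by
  apply h.re_le
  have h1 : ‖F k z‖ < s k - τ k := hz
  have := h.τ_pos k
  linarith

lemma mem_succ_of_le (h : ShearData u σ η s τ T F) {k : ℕ} {z : ℂ} (hz : ‖F k z‖ ≤ s k - τ k) :
    z ∈ sublevel F s τ (k + 1) := by
  have h0 := h.τ_pos k
  have h1 := h.dist_lt k z (h.re_le (by linarith))
  have h2 := norm_le_norm_add_norm_sub' (F (k + 1) z) (F k z)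
  have h3 := h.s_mono (Nat.le_succ k)
  show ‖F (k + 1) z‖ < s (k + 1) - τ (k + 1)
  simp only [Nat.succ_eq_add_one] at h3
  linarith

lemma sublevel_mono (h : ShearData u σ η s τ T F) : Monotone (sublevel F s τ) :=
  monotone_nat_of_le_succ fun k z (hz : z ∈ sublevel F s τ k) => by
    have h1 : ‖F k z‖ < s k - τ k := hz
    exact h.mem_succ_of_le h1.le

lemma isOpen_sublevel (h : ShearData u σ η s τ T F) (k : ℕ) : IsOpen (sublevel F s τ k) :=
  isOpen_lt (h.differentiable k).continuous.norm continuous_const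

lemma norm_sub_le_of_mem (h : ShearData u σ η s τ T F) {k : ℕ} {z : ℂ}
    (hz : z ∈ sublevel F s τ k) {j : ℕ} (hj : k ≤ j) : ‖F j z - F k z‖ ≤ τ k - τ j := by
  induction j, hj using Nat.le_induction with
  | base => simp
  | succ j hj ih =>
    have h1 := h.dist_lt j z (h.re_le_of_mem (h.sublevel_mono hj hz))
    have h2 := norm_sub_le_norm_sub_add_norm_sub (F (j + 1) z) (F j z) (F k z)
    linarith

lemma exists_tendsto (h : ShearData u σ η s τ T F) {k : ℕ} {z : ℂ}
    (hz : z ∈ sublevel F s τ k) : ∃ L, Filter.Tendsto (fun j => F j z) Filter.atTop (nhds L) := by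
  have hc : CauchySeq fun n => F (k + n) z := by
    refine cauchySeq_of_le_tendsto_0' (fun n => τ (k + n)) (fun n m hnm => ?_) ?_
    · rw [dist_comm, dist_eq_norm]
      have h1 := h.norm_sub_le_of_mem (h.sublevel_mono (Nat.le_add_right k n) hz)
        (Nat.add_le_add_left hnm k)
      have h2 := h.τ_pos (k + m)
      linarith
    · have := (Filter.tendsto_add_atTop_iff_nat k).2 h.τ_tendsto
      simpa [add_comm] using this
  obtain ⟨L, hL⟩ := cauchySeq_tendsto_of_complete hc
  refine ⟨L, (Filter.tendsto_add_atTop_iff_nat k).1 ?_⟩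
  simpa [add_comm] using hL

/-- The limit map. -/
def lim (F : ℕ → ℂ → H2) (z : ℂ) : H2 := Filter.limUnder Filter.atTop fun j => F j z

lemma tendsto_lim (h : ShearData u σ η s τ T F) {k : ℕ} {z : ℂ}
    (hz : z ∈ sublevel F s τ k) : Filter.Tendsto (fun j => F j z) Filter.atTop (nhds (lim F z)) :=
  tendsto_nhds_limUnder (h.exists_tendsto hz)

lemma norm_sub_lim_le (h : ShearData u σ η s τ T F) {k : ℕ} {z : ℂ}
    (hz : z ∈ sublevel F s τ k) : ‖lim F z - F k z‖ ≤ τ k := by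
  refine le_of_tendsto ((h.tendsto_lim hz).sub_const (F k z)).norm ?_
  filter_upwards [Filter.eventually_ge_atTop k] with j hj
  have := h.norm_sub_le_of_mem hz hj
  have := h.τ_pos j
  linarith

lemma norm_lim_lt (h : ShearData u σ η s τ T F) {k : ℕ} {z : ℂ}
    (hz : z ∈ sublevel F s τ k) : ‖lim F z‖ < 1 := by
  have h1 := h.norm_sub_lim_le hz
  have h2 := norm_le_norm_add_norm_sub' (lim F z) (F k z)
  have h3 : ‖F k z‖ < s k - τ k := hz
  have := h.s_lt k
  linarith

lemma dist_lower (h : ShearData u σ η s τ T F) {k : ℕ} {z w : ℂ}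
    (hz : z ∈ sublevel F s τ k) (hw : w ∈ sublevel F s τ k) {j : ℕ} (hj : k ≤ j) :
    (1 - (τ k - τ j)) * ‖F k z - F k w‖ ≤ ‖F j z - F j w‖ := by
  induction j, hj using Nat.le_induction with
  | base => simp
  | succ j hj ih =>
    have h1 := h.dist_sub_le j z w (h.re_le_of_mem (h.sublevel_mono hj hz))
      (h.re_le_of_mem (h.sublevel_mono hj hw))
    have h2 : ‖F j z - F j w‖ ≤ ‖F (j + 1) z - F (j + 1) w‖
        + ‖(F (j + 1) z - F j z) - (F (j + 1) w - F j w)‖ := by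
      have : F j z - F j w = (F (j + 1) z - F (j + 1) w) -
        ((F (j + 1) z - F j z) - (F (j + 1) w - F j w)) := by abel
      conv_lhs => rw [this]
      exact norm_sub_le _ _
    have h3 : (1 - (τ j - τ (j + 1))) * ‖F j z - F j w‖ ≤ ‖F (j + 1) z - F (j + 1) w‖ := by
      linarith
    refine le_trans ?_ h3
    have a1 := h.τ_antitone (Nat.zero_le k)
    have a2 := h.τ_antitone hj
    have a3 := h.τ_lt j
    have a4 := h.τ_pos (j + 1)
    have a5 := h.τ_zero
    have a6 := norm_nonneg (F k z - F k w)
    have h4 : (1 - (τ j - τ (j + 1))) * ((1 - (τ k - τ j)) * ‖F k z - F k w‖) ≤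
        (1 - (τ j - τ (j + 1))) * ‖F j z - F j w‖ := by
      apply mul_le_mul_of_nonneg_left ih
      linarith
    refine le_trans ?_ h4
    rw [← mul_assoc]
    apply mul_le_mul_of_nonneg_right _ a6
    nlinarith

lemma dist_lim_lower (h : ShearData u σ η s τ T F) {k : ℕ} {z w : ℂ}
    (hz : z ∈ sublevel F s τ k) (hw : w ∈ sublevel F s τ k) :
    1 / 2 * ‖F k z - F k w‖ ≤ ‖lim F z - lim F w‖ := by
  refine ge_of_tendsto ((h.tendsto_lim hz).sub (h.tendsto_lim hw)).norm ?_
  filter_upwards [Filter.eventually_ge_atTop k] with j hj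
  refine le_trans ?_ (h.dist_lower hz hw hj)
  have a1 := h.τ_antitone (Nat.zero_le k)
  have a4 := h.τ_pos j
  have a5 := h.τ_zero
  gcongr
  linarith

/-- The exhausting components. -/
def comp (F : ℕ → ℂ → H2) (s τ : ℕ → ℝ) (k : ℕ) : Set ℂ := connectedComponentIn (sublevel F s τ k) 0

lemma zero_mem_sublevel (h : ShearData u σ η s τ T F) (k : ℕ) : (0 : ℂ) ∈ sublevel F s τ k := by
  show ‖F k 0‖ < s k - τ k
  have h1 := h.norm_zero k
  have h2 := h.half_le.trans (h.s_mono (Nat.zero_le k))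
  have := h.τ_zero
  linarith

lemma comp_mono (h : ShearData u σ η s τ T F) : Monotone (comp F s τ) := fun _ _ hjk =>
  connectedComponentIn_mono _ (h.sublevel_mono hjk)

lemma comp_subset_sublevel (k : ℕ) : comp F s τ k ⊆ sublevel F s τ k :=
  connectedComponentIn_subset _ _

lemma component_antitone (h : ShearData u σ η s τ T F) :
    Antitone fun k : ℕ => connectedComponentIn {z | ‖F k z‖ < 1 + 1 / (k + 1 : ℝ)} 0 :=
  antitone_nat_of_succ_le h.component

lemma comp_subset (h : ShearData u σ η s τ T F) (j m : ℕ) :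
    comp F s τ j ⊆ connectedComponentIn {z | ‖F m z‖ < 1 + 1 / (m + 1 : ℝ)} 0 := by
  have h1 := h.comp_mono (le_max_left j m)
  refine h1.trans (Subset.trans ?_ (h.component_antitone (le_max_right j m)))
  apply connectedComponentIn_mono
  intro z hz
  have h2 : ‖F (max j m) z‖ < s (max j m) - τ (max j m) := hz
  have h3 := h.τ_pos (max j m)
  have h4 := h.s_lt (max j m)
  have h5 : (0 : ℝ) < 1 / ((max j m : ℕ) + 1 : ℝ) := by positivity
  show ‖F (max j m) z‖ < 1 + 1 / ((max j m : ℕ) + 1 : ℝ)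
  linarith

/-- The limit domain. -/
def domain (F : ℕ → ℂ → H2) (s τ : ℕ → ℝ) : Set ℂ := ⋃ k, comp F s τ k

lemma exists_mem_comp (h : ShearData u σ η s τ T F) {z : ℂ} (hz : z ∈ domain F s τ) (m : ℕ) :
    ∃ k ≥ m, z ∈ comp F s τ k := by
  obtain ⟨j, hj⟩ := mem_iUnion.1 hz
  exact ⟨max j m, le_max_right _ _, h.comp_mono (le_max_left _ _) hj⟩

lemma mem_domain_of_mem_closure (h : ShearData u σ η s τ T F) {z : ℂ} {k : ℕ}
    (hz : z ∈ closure (domain F s τ)) (hk : z ∈ sublevel F s τ k) : z ∈ domain F s τ := by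
  have ho : IsOpen (connectedComponentIn (sublevel F s τ k) z) :=
    (h.isOpen_sublevel k).connectedComponentIn
  obtain ⟨w, hw1, hw2⟩ := mem_closure_iff.1 hz _ ho (mem_connectedComponentIn hk)
  obtain ⟨j, hj, hwj⟩ := h.exists_mem_comp hw2 k
  have h1 : connectedComponentIn (sublevel F s τ k) z ⊆ connectedComponentIn (sublevel F s τ j) 0 := by
    rw [connectedComponentIn_eq hwj]
    exact isPreconnected_connectedComponentIn.subset_connectedComponentIn hw1
      ((connectedComponentIn_subset _ _).trans (h.sublevel_mono hj))
  exact mem_iUnion.2 ⟨j, h1 (mem_connectedComponentIn hk)⟩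

lemma isOpen_comp (h : ShearData u σ η s τ T F) (k : ℕ) : IsOpen (comp F s τ k) :=
  (h.isOpen_sublevel k).connectedComponentIn

lemma isOpen_domain (h : ShearData u σ η s τ T F) : IsOpen (domain F s τ) :=
  isOpen_iUnion h.isOpen_comp

lemma domain_subset (h : ShearData u σ η s τ T F) (m : ℕ) :
    domain F s τ ⊆ connectedComponentIn {z | ‖F m z‖ < 1 + 1 / (m + 1 : ℝ)} 0 :=
  iUnion_subset fun j => h.comp_subset j m

lemma isBounded_domain (h : ShearData u σ η s τ T F) : Bornology.IsBounded (domain F s τ) := by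
  have h1 := h.domain_subset 0
  have : (1 + 1 / ((0 : ℕ) + 1 : ℝ)) = 2 := by norm_num
  rw [this] at h1
  exact h.bounded.subset h1

lemma exhaustedDomain (h : ShearData u σ η s τ T F) :
    ExhaustedDomain (domain F s τ) (comp F s τ) where
  bounded := h.isBounded_domain
  isOpen := h.isOpen_comp
  preconnected _ := isPreconnected_connectedComponentIn
  mono := h.comp_mono
  zero_mem k := mem_connectedComponentIn (h.zero_mem_sublevel k)
  iUnion := rfl
  closure_subset k z hz := by
    have h1 : closure (comp F s τ k) ⊆ {z | ‖F k z‖ ≤ s k - τ k} :=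
      closure_minimal (fun z hz => le_of_lt (show ‖F k z‖ < s k - τ k from comp_subset_sublevel k hz))
        (isClosed_le (h.differentiable k).continuous.norm continuous_const)
    exact h.mem_domain_of_mem_closure (closure_mono (subset_iUnion _ k) hz)
      (h.mem_succ_of_le (h1 hz))
  fill O hO hOb hfr := by
    have hfc : IsCompact (frontier O) :=
      Metric.isCompact_of_isClosed_isBounded isClosed_frontier
        (hOb.closure.subset frontier_subset_closure)
    obtain ⟨k, hk⟩ := hfc.elim_directed_cover _ h.isOpen_comp hfr
      (directed_of_isDirected_le h.comp_mono)
    have hOG : O ⊆ sublevel F s τ (k + 1) := by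
      intro z hz
      apply h.mem_succ_of_le
      refine Complex.norm_le_of_forall_mem_frontier_norm_le hOb
        (h.differentiable k).diffContOnCl (fun w hw => ?_) (subset_closure hz)
      exact le_of_lt (show ‖F k w‖ < s k - τ k from comp_subset_sublevel k (hk hw))
    have hW : O \ domain F s τ = O \ closure (domain F s τ) := by
      ext z
      refine ⟨fun hz => ⟨hz.1, fun hc => hz.2 (h.mem_domain_of_mem_closure hc (hOG hz.1))⟩,
        fun hz => ⟨hz.1, fun hc => hz.2 (subset_closure hc)⟩⟩
    have hWo : IsOpen (O \ domain F s τ) := by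
      rw [hW]; exact hO.sdiff isClosed_closure
    have hWc : IsClosed (O \ domain F s τ) := by
      rw [← closure_subset_iff_isClosed]
      intro z hz
      have h1 : z ∉ domain F s τ := by
        have : closure (O \ domain F s τ) ⊆ (domain F s τ)ᶜ :=
          closure_minimal (fun z hz => hz.2) h.isOpen_domain.isClosed_compl
        exact this hz
      have h2 : z ∈ closure O := closure_mono sdiff_subset hz
      refine ⟨?_, h1⟩
      by_contra h3
      exact h1 (hfr ⟨h2, by rwa [hO.interior_eq]⟩)
    rcases isClopen_iff.1 ⟨hWc, hWo⟩ with h1 | h1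
    · exact sdiff_eq_empty.1 h1
    · exfalso
      have : (0 : ℂ) ∈ O \ domain F s τ := by rw [h1]; trivial
      exact this.2 (mem_iUnion.2 ⟨0, mem_connectedComponentIn (h.zero_mem_sublevel 0)⟩)

end ShearData

namespace ShearData

variable {u : ℕ → H2} {σ η s τ : ℕ → ℝ} {T : ℕ → Set H2} {F : ℕ → ℂ → H2}

lemma differentiableOn_lim (h : ShearData u σ η s τ T F) :
    DifferentiableOn ℂ (lim F) (domain F s τ) := by
  have hu : TendstoLocallyUniformlyOn F (lim F) Filter.atTop (domain F s τ) := by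
    rw [Metric.tendstoLocallyUniformlyOn_iff]
    intro ε hε z hz
    obtain ⟨k, hk⟩ := mem_iUnion.1 hz
    refine ⟨sublevel F s τ k, mem_nhdsWithin_of_mem_nhds
      ((h.isOpen_sublevel k).mem_nhds (comp_subset_sublevel k hk)), ?_⟩
    filter_upwards [h.τ_tendsto.eventually_lt_const hε, Filter.eventually_ge_atTop k]
      with j hj hkj w hw
    rw [dist_eq_norm]
    exact (h.norm_sub_lim_le (h.sublevel_mono hkj hw)).trans_lt hj
  exact hu.differentiableOn (Filter.Eventually.of_forall fun k =>
    (h.differentiable k).differentiableOn) h.isOpen_domain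

lemma injOn_lim (h : ShearData u σ η s τ T F) : InjOn (lim F) (domain F s τ) := by
  intro z hz w hw hzw
  obtain ⟨j, hj⟩ := mem_iUnion.1 hz
  obtain ⟨k, hk, hwk⟩ := h.exists_mem_comp hw j
  have h1 := h.dist_lim_lower (comp_subset_sublevel k (h.comp_mono hk hj))
    (comp_subset_sublevel k hwk)
  rw [hzw, sub_self, norm_zero] at h1
  apply h.injective k
  rw [← sub_eq_zero, ← norm_le_zero_iff]
  linarith

lemma deriv_lim_ne (h : ShearData u σ η s τ T F) {z : ℂ} (hz : z ∈ domain F s τ) :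
    deriv (lim F) z ≠ 0 := by
  intro h0
  obtain ⟨k, hk⟩ := mem_iUnion.1 hz
  have hd : HasDerivAt (lim F) (deriv (lim F) z) z :=
    ((h.differentiableOn_lim).differentiableAt (h.isOpen_domain.mem_nhds hz)).hasDerivAt
  have hk' := comp_subset_sublevel k hk
  have h1 := (hasDerivAt_iff_tendsto_slope.1 hd).norm
  have h2 := ((hasDerivAt_iff_tendsto_slope.1 (h.differentiable k z).hasDerivAt).norm).const_mul
    (1 / 2 : ℝ)
  have h3 := le_of_tendsto_of_tendsto h2 h1 (by
    filter_upwards [mem_nhdsWithin_of_mem_nhds ((h.isOpen_sublevel k).mem_nhds hk')] with w hw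
    rw [slope_def_module, slope_def_module, norm_smul, norm_smul]
    have := h.dist_lim_lower hw hk'
    have h5 := norm_nonneg (w - z)⁻¹
    nlinarith)
  rw [h0, norm_zero] at h3
  exact h.deriv_ne k z (norm_le_zero_iff.1 (by linarith))

lemma norm_lim_lt_one (h : ShearData u σ η s τ T F) {z : ℂ} (hz : z ∈ domain F s τ) :
    ‖lim F z‖ < 1 := by
  obtain ⟨k, hk⟩ := mem_iUnion.1 hz
  exact h.norm_lim_lt (comp_subset_sublevel k hk)

lemma downward {P : ℕ → Prop} {k : ℕ} (hev : ∃ j ≥ k, P j) (hstep : ∀ i ≥ k, P (i + 1) → P i) :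
    P k := by
  obtain ⟨j, hj, hP⟩ := hev
  induction j, hj using Nat.le_induction with
  | base => exact hP
  | succ j hj ih => exact ih (hstep j hj hP)

lemma isCompact_sublevel_lim (h : ShearData u σ η s τ T F) {r : ℝ} (hr : r < 1) :
    IsCompact {z ∈ domain F s τ | ‖lim F z‖ ≤ r} := by
  have hlim : Filter.Tendsto (fun k => s k - τ k - τ k) Filter.atTop (nhds 1) := by
    simpa using (h.s_tendsto.sub h.τ_tendsto).sub h.τ_tendsto
  obtain ⟨k, hk⟩ := (hlim.eventually_const_lt hr).exists
  have hkey : ∀ z ∈ domain F s τ, ‖lim F z‖ ≤ r → ‖F k z‖ ≤ r + τ k := by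
    intro z hz hzr
    refine downward (P := fun i => ‖F i z‖ ≤ r + τ i) ?_ ?_
    · obtain ⟨j, hj, hzj⟩ := h.exists_mem_comp hz k
      refine ⟨j, hj, ?_⟩
      have h1 := h.norm_sub_lim_le (comp_subset_sublevel j hzj)
      have h2 := norm_le_norm_add_norm_sub (lim F z) (F j z)
      linarith
    · intro i hi hi1
      have a1 := h.τ_lt i
      have a2 := h.τ_antitone hi
      have a3 := h.s_mono hi
      have a4 := h.τ_pos k
      have a5 : (inner ℂ (u i) (F i z)).re ≤ σ i - 2 * η i := by
        rw [← h.inner_eq]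
        refine (re_inner_le_norm_of_unit (h.norm_u i) _).trans (le_trans ?_ (h.s_le i))
        linarith
      have a6 := h.dist_lt i z a5
      have a7 := norm_le_norm_add_norm_sub (F (i + 1) z) (F i z)
      linarith
  have heq : {z ∈ domain F s τ | ‖lim F z‖ ≤ r}
      = closure (domain F s τ) ∩ {z | ‖F k z‖ ≤ r + τ k} ∩ {z | ‖lim F z‖ ≤ r} := by
    ext z
    constructor
    · rintro ⟨h1, h2⟩
      exact ⟨⟨subset_closure h1, hkey z h1 h2⟩, h2⟩
    · rintro ⟨⟨h1, h2⟩, h3⟩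
      refine ⟨h.mem_domain_of_mem_closure (k := k) h1 ?_, h3⟩
      have h4 : ‖F k z‖ ≤ r + τ k := h2
      show ‖F k z‖ < s k - τ k
      linarith
  have hsub : closure (domain F s τ) ∩ {z | ‖F k z‖ ≤ r + τ k} ⊆ domain F s τ := by
    rintro z ⟨h1, h2⟩
    refine h.mem_domain_of_mem_closure (k := k) h1 ?_
    have h4 : ‖F k z‖ ≤ r + τ k := h2
    show ‖F k z‖ < s k - τ k
    linarith
  have hC : IsCompact (closure (domain F s τ) ∩ {z | ‖F k z‖ ≤ r + τ k}) :=
    h.isBounded_domain.isCompact_closure.inter_right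
      (isClosed_le (h.differentiable k).continuous.norm continuous_const)
  rw [heq]
  have hcl := (h.differentiableOn_lim.continuousOn.mono hsub).norm.preimage_isClosed_of_isClosed
    hC.isClosed (isClosed_Iic (a := r))
  exact hC.of_isClosed_subset hcl inter_subset_left

lemma lim_notMem (h : ShearData u σ η s τ T F) {z : ℂ} (hz : z ∈ domain F s τ) (j : ℕ) :
    lim F z ∉ T j := by
  intro hT
  have hkey : ‖lim F z - F (j + 1) z‖ ≤ τ (j + 1) := by
    refine downward (P := fun i => ‖lim F z - F i z‖ ≤ τ i) ?_ ?_
    · obtain ⟨i, hi, hzi⟩ := h.exists_mem_comp hz (j + 1)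
      exact ⟨i, hi, h.norm_sub_lim_le (comp_subset_sublevel i hzi)⟩
    · intro i hi hi1
      have a1 := h.le_of_mem_of_lt j i hi _ hT
      have a2 := re_inner_le_norm_of_unit (h.norm_u i) (F (i + 1) z - lim F z)
      rw [inner_sub_right, Complex.sub_re, h.inner_eq, norm_sub_rev] at a2
      have a3 := h.τ_le i
      have a4 := h.dist_lt i z (by linarith)
      have a5 := norm_sub_le_norm_sub_add_norm_sub (lim F z) (F (i + 1) z) (F i z)
      linarith
  have a1 := h.le_of_mem j _ hT
  have a2 := re_inner_le_norm_of_unit (h.norm_u j) (lim F z - F (j + 1) z)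
  rw [inner_sub_right, Complex.sub_re] at a2
  have a3 := h.τ_le j
  have a4 := h.re_lt j z (by exact_mod_cast h.domain_subset (j + 1) hz)
  linarith

end ShearData

/-- A wall sequence is avoided by a proper holomorphic embedding of some domain without holes. -/
theorem IsWallSequence.exists_embedded_domain {u : ℕ → H2} {σ η s : ℕ → ℝ} {T : ℕ → Set H2}
    (hw : IsWallSequence u σ η s T) :
    ∃ (D : Set ℂ) (V : ℕ → Set ℂ) (F : ℂ → H2), ExhaustedDomain D V ∧ DifferentiableOn ℂ F D ∧
      InjOn F D ∧ (∀ z ∈ D, deriv F z ≠ 0) ∧ (∀ z ∈ D, ‖F z‖ < 1) ∧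
      (∀ r < 1, IsCompact {z ∈ D | ‖F z‖ ≤ r}) ∧ ∀ z ∈ D, ∀ j, F z ∉ T j := by
  obtain ⟨τ, h0, hpos, hlt, hle, hlim⟩ := exists_tail_seq hw.η_pos
  obtain ⟨F, hF⟩ := exists_shear_sequence hw h0 hpos hlt
  have h : ShearData u σ η s τ T F := { hw, hF with
    τ_zero := h0, τ_pos := hpos, τ_lt := hlt, τ_le := hle, τ_tendsto := hlim }
  exact ⟨_, _, _, h.exhaustedDomain, h.differentiableOn_lim, h.injOn_lim,
    fun z hz => h.deriv_lim_ne hz, fun z hz => h.norm_lim_lt_one hz,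
    fun r hr => h.isCompact_sublevel_lim hr, fun z hz j => h.lim_notMem hz j⟩

lemma exists_separated_nets (E : Type*) [NormedAddCommGroup E] [InnerProductSpace ℝ E]
    [FiniteDimensional ℝ E] [Nontrivial E] :
    ∃ m : ℕ, 0 < m ∧ ∀ τ : ℝ, 0 < τ → ∃ P : ℕ → Finset E, (∀ i, (P i).Nonempty) ∧
      (∀ i, ∀ p ∈ P i, ‖p‖ = 1) ∧
      (∀ i, ∀ p ∈ P i, ∀ q ∈ P i, p ≠ q → 8 * τ ≤ ‖p - q‖) ∧
      ∀ q : E, ‖q‖ = 1 → ∃ i < m, ∃ p ∈ P i, ‖p - q‖ ≤ τ / 4 := by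
  classical
  set n := Module.finrank ℝ E with hn
  have hnpos : 0 < n := Module.finrank_pos
  have hnR : (0 : ℝ) < n := by exact_mod_cast hnpos
  let b : OrthonormalBasis (Fin n) ℝ E := stdOrthonormalBasis ℝ E
  set M := 66 * n with hM
  have : NeZero M := ⟨by positivity⟩
  obtain ⟨w, hw⟩ : ∃ w : E, ‖w‖ = 1 := by
    obtain ⟨x, hx⟩ := exists_ne (0 : E)
    exact ⟨‖x‖⁻¹ • x, norm_smul_inv_norm' (𝕜 := ℝ) (r := 1) (by simp) hx |> fun h => by simpa using h⟩
  refine ⟨Fintype.card (Fin n → ZMod M), Fintype.card_pos, fun τ hτ => ?_⟩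
  set h := τ / (8 * n) with hh
  have hhpos : 0 < h := by positivity
  let e : (Fin n → ℤ) → E := fun x => ∑ i, (h * x i) • b i
  have he : ∀ x i, b.repr (e x) i = h * x i := by
    intro x i
    have := b.repr_apply_apply (e x) i
    rw [this]
    simp only [e]
    exact b.orthonormal.inner_right_fintype (fun i => h * (x i : ℝ)) i
  have hcoord : ∀ z i, |b.repr z i| ≤ ‖z‖ := by
    intro z i
    rw [b.repr_apply_apply]
    have := abs_real_inner_le_norm (b i) z
    rwa [b.norm_eq_one, one_mul] at this
  let B : ℤ := ⌈(1 + τ / 16) / h⌉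
  let A : (Fin n → ZMod M) → Finset (Fin n → ℤ) := fun c =>
    (Finset.Icc (fun _ => -B) (fun _ => B)).filter fun x =>
      |1 - ‖e x‖| ≤ τ / 16 ∧ e x ≠ 0 ∧ ∀ i, (x i : ZMod M) = c i
  let Q : (Fin n → ZMod M) → Finset E := fun c =>
    if (A c).Nonempty then (A c).image fun x => ‖e x‖⁻¹ • e x else {w}
  let eq := Fintype.equivFin (Fin n → ZMod M)
  let cl : ℕ → (Fin n → ZMod M) := fun i =>
    if hi : i < Fintype.card (Fin n → ZMod M) then eq.symm ⟨i, hi⟩ else 0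
  have hunit : ∀ x, e x ≠ 0 → ‖‖e x‖⁻¹ • e x‖ = 1 := by
    intro x hx
    rw [norm_smul, norm_inv, norm_norm, inv_mul_cancel₀ (norm_ne_zero_iff.2 hx)]
  have hclose : ∀ x, e x ≠ 0 → ‖‖e x‖⁻¹ • e x - e x‖ = |1 - ‖e x‖| := by
    intro x hx
    have h1 : ‖e x‖⁻¹ • e x - e x = (1 - ‖e x‖) • (‖e x‖⁻¹ • e x) := by
      rw [sub_smul, one_smul, smul_smul, mul_inv_cancel₀ (norm_ne_zero_iff.2 hx), one_smul]
    rw [h1, norm_smul, hunit x hx, mul_one, Real.norm_eq_abs]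
  refine ⟨fun i => Q (cl i), fun i => ?_, fun i p hp => ?_, fun i p hp q hq hpq => ?_, fun q hq => ?_⟩
  · simp only [Q]
    split_ifs with hA
    · exact hA.image _
    · exact Finset.singleton_nonempty w
  · simp only [Q] at hp
    split_ifs at hp with hA
    · obtain ⟨x, hx, rfl⟩ := Finset.mem_image.1 hp
      exact hunit x (Finset.mem_filter.1 hx).2.2.1
    · rw [Finset.mem_singleton.1 hp, hw]
  · simp only [Q] at hp hq
    split_ifs at hp hq with hA
    · obtain ⟨x, hx, rfl⟩ := Finset.mem_image.1 hp
      obtain ⟨y, hy, rfl⟩ := Finset.mem_image.1 hq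
      obtain ⟨-, hx1, hx0, hxc⟩ := Finset.mem_filter.1 hx
      obtain ⟨-, hy1, hy0, hyc⟩ := Finset.mem_filter.1 hy
      have hxy : x ≠ y := fun h => hpq (by rw [h])
      obtain ⟨j, hj⟩ := Function.ne_iff.1 hxy
      have h1 : (M : ℤ) ∣ x j - y j := by
        rw [← ZMod.intCast_zmod_eq_zero_iff_dvd]
        push_cast
        rw [hxc, hyc, sub_self]
      have h2 : (M : ℤ) ≤ |x j - y j| := Int.le_of_dvd (abs_pos.2 (sub_ne_zero.2 hj))
        ((dvd_abs _ _).2 h1)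
      have h3 : (M : ℝ) ≤ |(x j : ℝ) - y j| := by exact_mod_cast h2
      have h4 := hcoord (e x - e y) j
      rw [map_sub, PiLp.sub_apply, he, he, ← mul_sub, abs_mul, abs_of_pos hhpos] at h4
      have h5 : h * M ≤ ‖e x - e y‖ := le_trans (by gcongr) h4
      have h6 : h * M = 33 / 4 * τ := by
        rw [hh, hM]; push_cast; field_simp; norm_num
      have h7 := norm_sub_le_norm_sub_add_norm_sub (e x) (‖e x‖⁻¹ • e x) (e y)
      have h8 := norm_sub_le_norm_sub_add_norm_sub (‖e x‖⁻¹ • e x) (‖e y‖⁻¹ • e y) (e y)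
      rw [hclose y hy0] at h8
      rw [norm_sub_rev (e x) (‖e x‖⁻¹ • e x), hclose x hx0] at h7
      linarith
    · exact absurd (by rw [Finset.mem_singleton.1 hp, Finset.mem_singleton.1 hq]) hpq
  · by_cases hbig : 8 ≤ τ
    · refine ⟨0, Fintype.card_pos, ?_⟩
      have hne : (Q (cl 0)).Nonempty := by
        simp only [Q]
        split_ifs with hA
        · exact hA.image _
        · exact Finset.singleton_nonempty w
      obtain ⟨p, hp⟩ := hne
      refine ⟨p, hp, ?_⟩
      have hp1 : ‖p‖ = 1 := by
        simp only [Q] at hp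
        split_ifs at hp with hA
        · obtain ⟨x, hx, rfl⟩ := Finset.mem_image.1 hp
          exact hunit x (Finset.mem_filter.1 hx).2.2.1
        · rw [Finset.mem_singleton.1 hp, hw]
      have := norm_sub_le p q
      linarith
    push Not at hbig
    let x : Fin n → ℤ := fun i => round (b.repr q i / h)
    have hr : ∀ i, |h * x i - b.repr q i| ≤ h / 2 := by
      intro i
      have h1 := abs_sub_round (b.repr q i / h)
      have h2 : h * x i - b.repr q i = -(h * (b.repr q i / h - round (b.repr q i / h))) := by
        simp only [x]; field_simp; ring
      rw [h2, abs_neg, abs_mul, abs_of_pos hhpos]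
      nlinarith
    have heq : ‖e x - q‖ ≤ τ / 16 := by
      have h1 : e x - q = ∑ i, (h * x i - b.repr q i) • b i := by
        conv_lhs => rw [← b.sum_repr q]
        simp only [e, ← Finset.sum_sub_distrib, sub_smul]
      rw [h1]
      refine (norm_sum_le _ _).trans ?_
      have h2 : ∀ i ∈ (Finset.univ : Finset (Fin n)),
          ‖(h * x i - b.repr q i) • b i‖ ≤ h / 2 := by
        intro i _
        rw [norm_smul, b.norm_eq_one, mul_one]
        exact hr i
      refine (Finset.sum_le_card_nsmul _ _ _ h2).trans ?_
      rw [Finset.card_univ, Fintype.card_fin, nsmul_eq_mul, hh]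
      apply le_of_eq
      field_simp; norm_num
    have h1e : |1 - ‖e x‖| ≤ τ / 16 := by
      have := abs_norm_sub_norm_le q (e x)
      rw [hq, norm_sub_rev] at this
      exact this.trans heq
    have hx0 : e x ≠ 0 := by
      intro h0
      rw [h0, norm_zero, sub_zero, abs_one] at h1e
      linarith
    have hxA : x ∈ A (fun i => (x i : ZMod M)) := by
      refine Finset.mem_filter.2 ⟨?_, h1e, hx0, fun i => rfl⟩
      have hxi : ∀ i, |(x i : ℝ)| ≤ B := by
        intro i
        have h1 := hcoord (e x) i
        rw [he, abs_mul, abs_of_pos hhpos] at h1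
        refine le_trans ?_ (Int.le_ceil _)
        rw [le_div_iff₀ hhpos]
        have := (abs_le.1 h1e).1
        linarith
      rw [Finset.mem_Icc, Pi.le_def, Pi.le_def]
      refine ⟨fun i => ?_, fun i => ?_⟩
      · have := (abs_le.1 (hxi i)).1; exact_mod_cast this
      · have := (abs_le.1 (hxi i)).2; exact_mod_cast this
    refine ⟨eq (fun i => (x i : ZMod M)), (eq _).2, ‖e x‖⁻¹ • e x, ?_, ?_⟩
    · have hcl : cl (eq (fun i => (x i : ZMod M))) = fun i => (x i : ZMod M) := by
        simp only [cl]
        rw [dif_pos (eq _).2]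
        simp
      show _ ∈ Q (cl _)
      rw [hcl]
      simp only [Q]
      rw [if_pos ⟨x, hxA⟩]
      exact Finset.mem_image_of_mem _ hxA
    · have h1 := norm_sub_le_norm_sub_add_norm_sub (‖e x‖⁻¹ • e x) (e x) q
      rw [hclose x hx0] at h1
      linarith

section Path

lemma exists_mem_Icc_norm_eq {E : Type*} [NormedAddCommGroup E] {c : ℝ → E} {a b r : ℝ}
    (hab : a ≤ b) (hc : ContinuousOn c (Icc a b))
    (ha : ‖c a‖ ≤ r) (hb : r ≤ ‖c b‖) : ∃ t ∈ Icc a b, ‖c t‖ = r :=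
  intermediate_value_Icc hab hc.norm ⟨ha, hb⟩

lemma le_eVariationOn_of_far {E : Type*} [NormedAddCommGroup E] {c : ℝ → E} {a b t δ : ℝ}
    (ht : t ∈ Icc a b)
    (h : δ ≤ ‖c t - c a‖) : ENNReal.ofReal δ ≤ eVariationOn c (Icc a b) := by
  refine le_trans ?_ (eVariationOn.edist_le c ht (left_mem_Icc.2 (ht.1.trans ht.2)))
  rw [edist_dist, dist_eq_norm]
  exact ENNReal.ofReal_le_ofReal h

variable {E : Type*} [NormedAddCommGroup E] [InnerProductSpace ℝ E]

/-- The flat disc of radius `τ` orthogonal to `p` and centred at `σ p`. -/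
def wall (p : E) (σ τ : ℝ) : Set E := {z | inner ℝ p z = σ ∧ ‖z - σ • p‖ ≤ τ}

lemma norm_sq_wall {p z : E} {σ τ : ℝ} (hp : ‖p‖ = 1) (hz : z ∈ wall p σ τ) :
    ‖z‖ ^ 2 ≤ σ ^ 2 + τ ^ 2 := by
  obtain ⟨h1, h2⟩ := hz
  have h3 : ‖z - σ • p‖ ^ 2 = ‖z‖ ^ 2 - σ ^ 2 := by
    rw [norm_sub_sq_real, inner_smul_right, real_inner_comm, h1, norm_smul, hp, mul_one,
      Real.norm_eq_abs, sq_abs]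
    ring
  have h4 := pow_le_pow_left₀ (norm_nonneg _) h2 2
  linarith

lemma inner_wall_of_separated {p q z : E} {σ τ : ℝ} (hp : ‖p‖ = 1) (hq : ‖q‖ = 1)
    (hσ : 1 / 2 ≤ σ) (hτ : 0 < τ) (hpq : 8 * τ ≤ ‖p - q‖) (hz : z ∈ wall p σ τ) :
    inner ℝ q z ≤ σ - 8 * τ ^ 2 := by
  obtain ⟨h1, h2⟩ := hz
  have h3 : inner ℝ q p = 1 - ‖p - q‖ ^ 2 / 2 := by
    rw [norm_sub_sq_real, hp, hq, real_inner_comm]; ring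
  have h4 : inner ℝ q z = σ * inner ℝ q p + inner ℝ (q - p) (z - σ • p) := by
    rw [inner_sub_left, inner_sub_right, inner_sub_right, inner_smul_right, inner_smul_right, h1,
      real_inner_self_eq_norm_sq, hp]
    ring
  have h5 : inner ℝ (q - p) (z - σ • p) ≤ ‖p - q‖ * τ := by
    refine (real_inner_le_norm _ _).trans ?_
    rw [norm_sub_rev q p]
    gcongr
  rw [h4, h3]
  nlinarith [norm_nonneg (p - q)]

lemma exists_far_of_avoid {P : ℕ → Finset E} {m : ℕ} {τ r r' : ℝ} {σ : ℕ → ℝ} {c : ℝ → E} {a b : ℝ}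
    (hunit : ∀ i, ∀ p ∈ P i, ‖p‖ = 1)
    (hnet : ∀ q : E, ‖q‖ = 1 → ∃ i < m, ∃ p ∈ P i, ‖p - q‖ ≤ τ / 4)
    (hτ : 0 < τ) (hτ1 : τ ≤ 1) (hr : 1 / 2 ≤ r) (hrσ : ∀ i < m, r ≤ σ i)
    (hr1 : r ≤ 1) (hr' : ∀ i < m, σ i ^ 2 + τ ^ 2 ≤ r' ^ 2)
    (hab : a ≤ b) (hc : ContinuousOn c (Icc a b)) (ha : ‖c a‖ = r) (hb : ‖c b‖ = r')
    (havoid : ∀ i < m, ∀ p ∈ P i, ∀ t ∈ Icc a b, c t ∉ wall p (σ i) τ) :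
    ∃ t ∈ Icc a b, τ / 4 ≤ ‖c t - c a‖ := by
  by_contra! hcon
  have hr0 : 0 < r := by linarith
  obtain ⟨i, hi, p, hp, hpq⟩ := hnet (r⁻¹ • c a) (by
    rw [norm_smul, ha, norm_inv, Real.norm_of_nonneg hr0.le, inv_mul_cancel₀ hr0.ne'])
  have hp1 := hunit i p hp
  have hpa : ‖c a - r • p‖ ≤ τ / 4 := by
    have h1 : c a - r • p = -(r • (p - r⁻¹ • c a)) := by
      rw [smul_sub, smul_smul, mul_inv_cancel₀ hr0.ne', one_smul]; abel
    rw [h1, norm_neg, norm_smul, Real.norm_of_nonneg hr0.le]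
    nlinarith [norm_nonneg (p - r⁻¹ • c a)]
  have horth : ∀ z : E, ∀ l : ℝ, ‖z - (inner ℝ p z : ℝ) • p‖ ^ 2 = ‖z‖ ^ 2 - (inner ℝ p z) ^ 2 ∧
      ‖z - (inner ℝ p z : ℝ) • p‖ ≤ ‖z - l • p‖ := by
    intro z l
    have h : ∀ l : ℝ, ‖z - l • p‖ ^ 2 = ‖z‖ ^ 2 - 2 * l * inner ℝ p z + l ^ 2 := by
      intro l
      rw [norm_sub_sq_real, inner_smul_right, real_inner_comm, norm_smul, hp1, mul_one,
        Real.norm_eq_abs, sq_abs]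
      ring
    refine ⟨by rw [h]; ring, ?_⟩
    rw [← pow_le_pow_iff_left₀ (norm_nonneg _) (norm_nonneg _) two_ne_zero, h, h]
    nlinarith [sq_nonneg (inner ℝ p z - l)]
  have hct : ∀ t ∈ Icc a b, ‖c t - (inner ℝ p (c t) : ℝ) • p‖ ≤ τ / 2 := by
    intro t ht
    refine (horth (c t) r).2.trans ?_
    have h1 := norm_sub_le_norm_sub_add_norm_sub (c t) (c a) (r • p)
    have h2 := hcon t ht
    linarith
  have hia : inner ℝ p (c a) ≤ σ i := by
    have h1 := real_inner_le_norm p (c a)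
    rw [hp1, ha, one_mul] at h1
    exact h1.trans (hrσ i hi)
  have hbmem : b ∈ Icc a b := right_mem_Icc.2 hab
  have hib : σ i ≤ inner ℝ p (c b) := by
    have h1 := hct b hbmem
    have h2 := (horth (c b) 0).1
    have h3 := pow_le_pow_left₀ (norm_nonneg _) h1 2
    rw [h2, hb] at h3
    have h4 := hr' i hi
    have hpos : 0 ≤ inner ℝ p (c b) := by
      have e1 : inner ℝ p (c b) = r + inner ℝ p (c a - r • p) + inner ℝ p (c b - c a) := by
        rw [inner_sub_right, inner_sub_right, inner_smul_right, real_inner_self_eq_norm_sq, hp1]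
        ring
      have e2 := neg_le_of_abs_le (abs_real_inner_le_norm p (c a - r • p))
      have e3 := neg_le_of_abs_le (abs_real_inner_le_norm p (c b - c a))
      have e4 := hcon b hbmem
      rw [hp1, one_mul] at e2 e3
      linarith
    nlinarith [hrσ i hi]
  obtain ⟨t, ht, hti⟩ := intermediate_value_Icc hab
    (f := fun t => inner ℝ p (c t)) (ContinuousOn.inner (𝕜 := ℝ) continuousOn_const hc) ⟨hia, hib⟩
  simp only at hti
  refine havoid i hi p hp t ht ⟨hti, ?_⟩
  have := hct t ht
  rw [hti] at this
  linarith

lemma eVariationOn_eq_top_of_avoid {m : ℕ} {τ σ : ℕ → ℝ} {P : ℕ → Finset E} (hm : 0 < m)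
    (hunit : ∀ i, ∀ p ∈ P i, ‖p‖ = 1) (hτ : ∀ b, 0 < τ b) (hτ1 : ∀ b, τ b ≤ 1)
    (hnet : ∀ b, ∀ q : E, ‖q‖ = 1 → ∃ i < m, ∃ p ∈ P (b * m + i), ‖p - q‖ ≤ τ b / 4)
    (hσ : Monotone σ) (hσ0 : 1 / 2 ≤ σ 0) (hσ1 : ∀ l, σ l < 1)
    (hσlim : Filter.Tendsto σ Filter.atTop (nhds 1))
    (hgap : ∀ b, ∀ i < m, σ (b * m + i) ^ 2 + τ b ^ 2 ≤ σ (b * m + i + 1) ^ 2)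
    (hsum : ¬ Summable τ) {c : ℝ → E} (hc : ContinuousOn c (Ico 0 1))
    (hc1 : ∀ t ∈ Ico (0 : ℝ) 1, ‖c t‖ < 1)
    (hclim : ∀ r < 1, ∃ t₀ ∈ Ico (0 : ℝ) 1, ∀ t ∈ Ico t₀ 1, r < ‖c t‖)
    (havoid : ∀ b, ∀ i < m, ∀ p ∈ P (b * m + i), ∀ t ∈ Ico (0 : ℝ) 1,
      c t ∉ wall p (σ (b * m + i)) (τ b)) :
    eVariationOn c (Ico 0 1) = ⊤ := by
  have hreach : ∀ t ∈ Ico (0 : ℝ) 1, ∀ l, ‖c t‖ ≤ σ l → ∃ t' ∈ Ico t 1, ‖c t'‖ = σ l := by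
    intro t ht l hl
    obtain ⟨t₀, ht₀, h⟩ := hclim (σ l) (hσ1 l)
    have h1 : max t t₀ ∈ Ico t₀ 1 := ⟨le_max_right _ _, max_lt ht.2 ht₀.2⟩
    obtain ⟨t', ht', h'⟩ := exists_mem_Icc_norm_eq (le_max_left t t₀)
      (hc.mono fun x hx => ⟨ht.1.trans hx.1, hx.2.trans_lt h1.2⟩) hl (h _ h1).le
    exact ⟨t', ⟨ht'.1, ht'.2.trans_lt h1.2⟩, h'⟩
  have hmain : ∀ n b, ∀ t ∈ Ico (0 : ℝ) 1, ‖c t‖ ≤ σ (b * m) →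
      ENNReal.ofReal (∑ i ∈ Finset.range n, τ (b + i) / 4) ≤ eVariationOn c (Ico t 1) := by
    intro n
    induction n with
    | zero => intro b t _ _; simp
    | succ n ih =>
      intro b t ht hb
      obtain ⟨a, ha, hac⟩ := hreach t ht _ hb
      have ha01 : a ∈ Ico (0 : ℝ) 1 := ⟨ht.1.trans ha.1, ha.2⟩
      obtain ⟨a', ha', hac'⟩ := hreach a ha01 ((b + 1) * m) (by
        rw [hac]; apply hσ; gcongr; omega)
      have ha'01 : a' ∈ Ico (0 : ℝ) 1 := ⟨ha01.1.trans ha'.1, ha'.2⟩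
      have hsubI : Icc a a' ⊆ Ico 0 1 := fun x hx => ⟨ha01.1.trans hx.1, hx.2.trans_lt ha'.2⟩
      have hm0 : 0 ≤ σ 0 := by linarith
      have hfar := exists_far_of_avoid (P := fun i => P (b * m + i)) (m := m) (τ := τ b)
        (σ := fun i => σ (b * m + i)) (fun i => hunit _) (hnet b) (hτ b) (hτ1 b)
        (hσ0.trans (hσ (Nat.zero_le _))) (fun i _ => hσ (Nat.le_add_right _ _)) (hσ1 _).le
        (r' := σ ((b + 1) * m)) (fun i hi => (hgap b i hi).trans (by
          have : b * m + i + 1 ≤ (b + 1) * m := by rw [add_mul, one_mul]; omega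
          have h1 := hσ this
          have h2 := hσ (Nat.zero_le (b * m + i + 1))
          gcongr
          linarith)) ha'.1 (hc.mono hsubI) hac hac'
        (fun i hi p hp x hx => havoid b i hi p hp x (hsubI hx))
      obtain ⟨x, hx, hfx⟩ := hfar
      have h1 := le_eVariationOn_of_far hx hfx
      have h2 := ih (b + 1) a' ha'01 hac'.le
      have h3 : eVariationOn c (Icc a a') + eVariationOn c (Ico a' 1) ≤ eVariationOn c (Ico t 1) :=
        (eVariationOn.add_le_union c fun x hx y hy => hx.2.trans hy.1).trans
          (eVariationOn.mono c (union_subset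
            (fun x hx => ⟨ha.1.trans hx.1, hx.2.trans_lt ha'.2⟩)
            (fun x hx => ⟨(ha.1.trans ha'.1).trans hx.1, hx.2⟩)))
      refine le_trans ?_ ((add_le_add h1 h2).trans h3)
      rw [Finset.sum_range_succ', ← ENNReal.ofReal_add (by have := hτ b; positivity)
        (Finset.sum_nonneg fun i _ => by have := hτ (b + 1 + i); positivity)]
      apply le_of_eq
      congr 1
      rw [add_comm]
      congr 1
      apply Finset.sum_congr rfl
      intro i _
      congr 2; ring
  have h0 : (0 : ℝ) ∈ Ico (0 : ℝ) 1 := by simp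
  obtain ⟨b, hb⟩ : ∃ b, ‖c 0‖ ≤ σ (b * m) := by
    obtain ⟨l, hl⟩ := (hσlim.eventually_const_lt (hc1 0 h0)).exists
    exact ⟨l, hl.le.trans (hσ (Nat.le_mul_of_pos_right l hm))⟩
  have hdiv : Filter.Tendsto (fun n => ∑ i ∈ Finset.range n, τ (b + i) / 4)
      Filter.atTop Filter.atTop := by
    have h1 : ¬ Summable fun i => τ (b + i) / 4 := by
      intro h
      apply hsum
      have h2 : Summable fun i => τ (i + b) := by
        refine (h.mul_right 4).congr fun i => ?_
        rw [div_mul_cancel₀ _ (by norm_num), add_comm]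
      exact (summable_nat_add_iff b).1 h2
    exact (not_summable_iff_tendsto_nat_atTop_of_nonneg (fun i => by
      have := hτ (b + i); positivity)).1 h1
  rw [eq_top_iff]
  have h4 := ENNReal.tendsto_ofReal_atTop.comp hdiv
  exact le_of_tendsto' h4 fun n => hmain n b 0 h0 hb

end Path

lemma Finset.exists_enumeration {α : Type*} [Inhabited α] (S : Finset α) : ∃ f : ℕ → α,
    (∀ i < S.card, f i ∈ S) ∧ (∀ i < S.card, ∀ j < S.card, f i = f j → i = j) ∧
      ∀ p ∈ S, ∃ i < S.card, f i = p := by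
  refine ⟨fun i => if h : i < S.card then (S.equivFin.symm ⟨i, h⟩ : α) else default,
    fun i hi => ?_, fun i hi j hj h => ?_, fun p hp => ?_⟩
  · simp only [dif_pos hi]; exact (S.equivFin.symm ⟨i, hi⟩).2
  · simp only [dif_pos hi, dif_pos hj] at h
    have := S.equivFin.symm.injective (Subtype.ext h)
    simpa using this
  · refine ⟨S.equivFin ⟨p, hp⟩, (S.equivFin ⟨p, hp⟩).2, ?_⟩
    simp

lemma exists_flatten {α : Type*} [Inhabited α] (P : ℕ → Finset α) (hP : ∀ l, (P l).Nonempty) :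
    ∃ (l : ℕ → ℕ) (p : ℕ → α), Monotone l ∧ (∀ k, p k ∈ P (l k)) ∧
      (∀ j k, j < k → l j = l k → p j ≠ p k) ∧ (∀ n, ∀ q ∈ P n, ∃ k, l k = n ∧ p k = q) := by
  choose f hf1 hf2 hf3 using fun l => (P l).exists_enumeration
  let N : ℕ → ℕ := fun n => ∑ i ∈ Finset.range n, (P i).card
  have hNs : ∀ n, N (n + 1) = N n + (P n).card := fun n => Finset.sum_range_succ _ _
  have hNm : StrictMono N := strictMono_nat_of_lt_succ fun n => by
    rw [hNs]; have := Finset.card_pos.2 (hP n); omega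
  have hex : ∀ k, ∃ n, k < N (n + 1) := fun k =>
    ⟨k, (Nat.lt_succ_self k).trans_le hNm.le_apply⟩
  let l : ℕ → ℕ := fun k => Nat.find (hex k)
  have hl1 : ∀ k, k < N (l k + 1) := fun k => Nat.find_spec (hex k)
  have hl2 : ∀ k, N (l k) ≤ k := by
    intro k
    rcases h : l k with _ | n
    · simp [N]
    · have : n < Nat.find (hex k) := by show n < l k; omega
      exact not_lt.1 (Nat.find_min (hex k) this)
  have hidx : ∀ k, k - N (l k) < (P (l k)).card := fun k => by
    have h1 := hl1 k; have h2 := hl2 k; rw [hNs] at h1; omega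
  refine ⟨l, fun k => f (l k) (k - N (l k)), fun j k hjk => ?_, fun k => hf1 _ _ (hidx k),
    fun j k hjk h1 h2 => ?_, fun n q hq => ?_⟩
  · exact Nat.find_min' (hex j) (hjk.trans_lt (hl1 k))
  · have h3 := hidx j
    have h4 := hidx k
    have h5 := hl2 j
    simp only at h2
    rw [h1] at h2 h3 h5
    have := hf2 _ _ h3 _ h4 h2
    have := hl2 k
    omega
  · obtain ⟨i, hi, rfl⟩ := hf3 n q hq
    have h1 : l (N n + i) = n := by
      apply le_antisymm
      · apply Nat.find_min'
        rw [hNs]; omega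
      · by_contra! hlt
        have h2 := hl1 (N n + i)
        have h3 := hNm.monotone (Nat.succ_le_of_lt hlt)
        simp only [Nat.succ_eq_add_one] at h3
        omega
    refine ⟨N n + i, h1, ?_⟩
    simp only [h1, Nat.add_sub_cancel_left]

lemma le_sub_of_sq_le {x y δ : ℝ} (hy : y ≤ 1) (hδ : 0 ≤ δ) (hδy : δ ≤ y)
    (h : x ^ 2 ≤ y ^ 2 - 2 * δ) : x ≤ y - δ := by
  refine (le_abs_self _).trans (abs_le_of_sq_le_sq ?_ (by linarith))
  nlinarith

/-- Radii of the successive layers. -/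
def layerRadius (l : ℕ) : ℝ := √(1 - 1 / (l + 2 : ℝ))

lemma layerRadius_sq (l : ℕ) : layerRadius l ^ 2 = 1 - 1 / (l + 2 : ℝ) := by
  apply Real.sq_sqrt
  have : (1 : ℝ) / (l + 2) ≤ 1 := by rw [div_le_one (by positivity)]; linarith [l.cast_nonneg (α := ℝ)]
  linarith

lemma layerRadius_nonneg (l : ℕ) : 0 ≤ layerRadius l := Real.sqrt_nonneg _

lemma layerRadius_lt_one (l : ℕ) : layerRadius l < 1 := by
  rw [← sq_lt_one_iff₀ (layerRadius_nonneg l), layerRadius_sq]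
  have : (0 : ℝ) < 1 / (l + 2) := by positivity
  linarith

lemma layerRadius_mono : Monotone layerRadius := by
  intro a b hab
  apply Real.sqrt_le_sqrt
  gcongr

lemma half_le_layerRadius (l : ℕ) : 1 / 2 ≤ layerRadius l := by
  refine le_trans ?_ (layerRadius_mono (Nat.zero_le l))
  rw [← pow_le_pow_iff_left₀ (by norm_num) (layerRadius_nonneg 0) two_ne_zero, layerRadius_sq]
  norm_num

lemma tendsto_layerRadius : Filter.Tendsto layerRadius Filter.atTop (nhds 1) := by
  have h1 : Filter.Tendsto (fun l : ℕ => 1 / (l + 2 : ℝ)) Filter.atTop (nhds 0) := by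
    have := (Filter.tendsto_add_atTop_iff_nat 1).2 (tendsto_one_div_add_atTop_nhds_zero_nat (𝕜 := ℝ))
    refine this.congr fun l => ?_
    push_cast; ring
  have h2 := (h1.const_sub 1).sqrt
  rw [sub_zero, Real.sqrt_one] at h2
  exact h2

lemma layerRadius_gap (l : ℕ) : layerRadius (l + 1) ^ 2 - layerRadius l ^ 2 =
    1 / ((l + 2) * (l + 3)) := by
  rw [layerRadius_sq, layerRadius_sq]
  push_cast
  field_simp
  ring

theorem exists_labyrinth (E : Type*) [NormedAddCommGroup E] [InnerProductSpace ℝ E]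
    [FiniteDimensional ℝ E] [Nontrivial E] :
    ∃ (u : ℕ → E) (σ η s : ℕ → ℝ) (T : ℕ → Set E),
      (∀ k, ‖u k‖ = 1) ∧ (∀ k, 0 < η k) ∧ (∀ k, ∀ z ∈ T k, σ k ≤ inner ℝ (u k) z) ∧
      (∀ j k, j < k → ∀ z ∈ T j, inner ℝ (u k) z ≤ σ k - 3 * η k) ∧ Monotone s ∧ 1 / 2 ≤ s 0 ∧
      (∀ k, s k < 1) ∧ Filter.Tendsto s Filter.atTop (nhds 1) ∧ (∀ k, s k ≤ σ k - 2 * η k) ∧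
      ∀ c : ℝ → E, ContinuousOn c (Ico 0 1) → (∀ t ∈ Ico (0 : ℝ) 1, ‖c t‖ < 1) →
        (∀ r < 1, ∃ t₀ ∈ Ico (0 : ℝ) 1, ∀ t ∈ Ico t₀ 1, r < ‖c t‖) →
        (∀ t ∈ Ico (0 : ℝ) 1, ∀ k, c t ∉ T k) → eVariationOn c (Ico 0 1) = ⊤ := by
  obtain ⟨m, hm, hnets⟩ := exists_separated_nets E
  let τ : ℕ → ℝ := fun b => 1 / (2 * (m + 3) * (b + 1))
  have hτ : ∀ b, 0 < τ b := fun b => by positivity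
  have hτ' : ∀ l : ℕ, τ (l / m) ≤ 1 / (2 * (l + 4)) := by
    intro l
    apply one_div_le_one_div_of_le (by positivity)
    have h1 : l + 4 ≤ (m + 3) * (l / m + 1) := by
      have h3 := Nat.lt_mul_div_succ l hm
      have h4 : (m + 3) * (l / m + 1) = m * (l / m + 1) + 3 * (l / m) + 3 := by ring
      omega
    have h2 : ((l : ℝ) + 4) ≤ (m + 3) * ((l / m : ℕ) + 1) := by exact_mod_cast h1
    linarith
  choose Q hQne hQunit hQsep hQnet using fun b => hnets (τ b) (hτ b)
  let P : ℕ → Finset E := fun l => Q (l / m) (l % m)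
  have hdm : ∀ b, ∀ i < m, (b * m + i) / m = b ∧ (b * m + i) % m = i := fun b i hi => by
    rw [mul_comm, Nat.mul_add_div hm, Nat.mul_add_mod, Nat.div_eq_of_lt hi, Nat.mod_eq_of_lt hi]
    simp
  have hPunit : ∀ i, ∀ p ∈ P i, ‖p‖ = 1 := fun i p hp => hQunit _ _ p hp
  have : Inhabited E := ⟨0⟩
  obtain ⟨l, p, hlm, hpP, hpne, hsurj⟩ := exists_flatten P fun l => hQne _ _
  let σ : ℕ → ℝ := fun l => layerRadius (l + 1)
  let η : ℕ → ℝ := fun l => τ (l / m) ^ 2 / 10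
  have hη : ∀ l, 0 < η l := fun l => by have := hτ (l / m); positivity
  have hτsq : ∀ n : ℕ, τ (n / m) ^ 2 ≤ 1 / (4 * ((n + 4) * (n + 4))) := fun n => by
    have := pow_le_pow_left₀ (hτ _).le (hτ' n) 2
    refine this.trans (le_of_eq ?_)
    field_simp; norm_num
  have hηle : ∀ l : ℕ, 6 * η l ≤ 1 / (2 * ((l + 2) * (l + 3))) := by
    intro n
    have h1 := hτsq n
    have h2 : (1 : ℝ) / (4 * ((n + 4) * (n + 4))) ≤ 1 / (2 * ((n + 2) * (n + 3))) := by
      apply one_div_le_one_div_of_le (by positivity)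
      nlinarith [n.cast_nonneg (α := ℝ)]
    have h3 : (0 : ℝ) < 1 / (2 * ((n + 2) * (n + 3))) := by positivity
    simp only [η]
    linarith
  have hηsmall : ∀ l, 3 * η l ≤ σ l := fun n => by
    have h1 := hηle n
    have h2 := half_le_layerRadius (n + 1)
    have h3 : (1 : ℝ) / (2 * ((n + 2) * (n + 3))) ≤ 1 / 12 := by
      apply one_div_le_one_div_of_le (by positivity)
      nlinarith [n.cast_nonneg (α := ℝ)]
    simp only [σ]; linarith
  have hgap : ∀ n : ℕ, σ n ^ 2 + τ (n / m) ^ 2 ≤ σ (n + 1) ^ 2 - 6 * η (n + 1) := by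
    intro n
    have h1 := layerRadius_gap (n + 1)
    have h2 := hτsq n
    have h3 := hηle (n + 1)
    push_cast at h1 h3
    have h5 : (1 : ℝ) / (4 * ((n + 4) * (n + 4))) ≤ 1 / (2 * ((n + 1 + 2) * (n + 1 + 3))) := by
      apply one_div_le_one_div_of_le (by positivity)
      nlinarith [n.cast_nonneg (α := ℝ)]
    have h6 : (1 : ℝ) / ((n + 1 + 2) * (n + 1 + 3)) = 1 / (2 * ((n + 1 + 2) * (n + 1 + 3)))
      + 1 / (2 * ((n + 1 + 2) * (n + 1 + 3))) := by field_simp; norm_num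
    simp only [σ]; linarith
  have hcross : ∀ n n', n < n' → ∀ x : ℝ, x ^ 2 ≤ σ n ^ 2 + τ (n / m) ^ 2 →
      x ≤ σ n' - 3 * η n' := by
    intro n n' hnn x hx
    apply le_sub_of_sq_le (layerRadius_lt_one _).le (by have := hη n'; positivity) (hηsmall n')
    obtain ⟨k, rfl⟩ : ∃ k, n' = k + 1 := ⟨n' - 1, by omega⟩
    rcases (Nat.lt_succ_iff.1 hnn).eq_or_lt with rfl | hlt
    · have := hgap n; linarith
    · have h1 := hgap n
      have h2 := hgap k
      have h3 : σ (n + 1) ^ 2 ≤ σ k ^ 2 :=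
        pow_le_pow_left₀ (layerRadius_nonneg _) (layerRadius_mono (by omega)) 2
      have := hη (n + 1)
      have := sq_nonneg (τ (k / m))
      linarith
  have hsσ : ∀ n, layerRadius n ≤ σ n - 2 * η n := by
    intro n
    apply le_sub_of_sq_le (layerRadius_lt_one _).le (by have := hη n; positivity)
      (by have := hη n; have := hηsmall n; linarith)
    have h1 := layerRadius_gap n
    have h2 := hηle n
    have h3 := hη n
    have h6 : (1 : ℝ) / ((n + 2) * (n + 3)) = 1 / (2 * ((n + 2) * (n + 3)))
      + 1 / (2 * ((n + 2) * (n + 3))) := by field_simp; norm_num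
    have h7 : (0 : ℝ) < 1 / (2 * ((n + 2) * (n + 3))) := by positivity
    change _ ≤ layerRadius (n + 1) ^ 2 - _
    linarith
  have hltop : Filter.Tendsto l Filter.atTop Filter.atTop := by
    refine Filter.tendsto_atTop_atTop_of_monotone hlm fun n => ?_
    obtain ⟨q, hq⟩ : (P n).Nonempty := hQne _ _
    obtain ⟨k, hk, -⟩ := hsurj n q hq
    exact ⟨k, hk.ge⟩
  refine ⟨p, fun k => σ (l k), fun k => η (l k), fun k => layerRadius (l k),
    fun k => wall (p k) (σ (l k)) (τ (l k / m)), fun k => hPunit _ _ (hpP k), fun k => hη _,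
    fun k z hz => hz.1.ge, fun j k hjk z hz => ?_, layerRadius_mono.comp hlm,
    half_le_layerRadius _, fun k => layerRadius_lt_one _, tendsto_layerRadius.comp hltop,
    fun k => hsσ _, fun c hc hc1 hclim havoid => ?_⟩
  · have hju := hPunit _ _ (hpP j)
    have hku := hPunit _ _ (hpP k)
    change z ∈ wall (p j) (σ (l j)) (τ (l j / m)) at hz
    change inner ℝ (p k) z ≤ σ (l k) - 3 * η (l k)
    rcases (hlm hjk.le).eq_or_lt with h | h
    · have hne := hpne j k hjk h
      have hpj := hpP j
      rw [h] at hpj hz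
      have h1 := inner_wall_of_separated hju hku (half_le_layerRadius _) (hτ _)
        (hQsep _ _ _ hpj _ (hpP k) hne) hz
      refine h1.trans ?_
      have := sq_nonneg (τ (l k / m))
      simp only [η]; linarith
    · have h1 := real_inner_le_norm (p k) z
      rw [hku, one_mul] at h1
      exact h1.trans (hcross _ _ h _ (norm_sq_wall hju hz))
  · refine eVariationOn_eq_top_of_avoid (σ := σ) (τ := τ) hm hPunit hτ ?_ ?_ ?_
      (half_le_layerRadius _) (fun k => layerRadius_lt_one _)
      ((Filter.tendsto_add_atTop_iff_nat 1).2 tendsto_layerRadius) ?_ ?_ hc hc1 hclim ?_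
    · intro b
      have : (1 : ℝ) ≤ 2 * (m + 3) * (b + 1) := by
        nlinarith [m.cast_nonneg (α := ℝ), b.cast_nonneg (α := ℝ),
          mul_nonneg (m.cast_nonneg (α := ℝ)) (b.cast_nonneg (α := ℝ))]
      exact (div_le_one (by positivity)).2 this
    · intro b q hq
      obtain ⟨i, hi, x, hx, hxq⟩ := hQnet b q hq
      refine ⟨i, hi, x, ?_, hxq⟩
      simp only [P, hdm b i hi]; exact hx
    · exact fun a b hab => layerRadius_mono (by omega)
    · intro b i hi
      have h1 := hgap (b * m + i)
      rw [(hdm b i hi).1] at h1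
      have := hη (b * m + i + 1)
      linarith
    · intro h
      have h1 := h.mul_left (2 * (m + 3 : ℝ))
      have h2 : Summable fun b : ℕ => 1 / ((b + 1 : ℕ) : ℝ) := by
        refine h1.congr fun b => ?_
        simp only [τ]; push_cast; field_simp
      exact Real.not_summable_one_div_natCast ((summable_nat_add_iff (f := fun n : ℕ => 1 / (n : ℝ)) 1).1 h2)
    · intro b i hi q hq t ht
      obtain ⟨k, hk, rfl⟩ := hsurj _ q hq
      have := havoid t ht k
      simp only [hk, (hdm b i hi).1] at this
      exact this

/-- The Cauchy–Riemann operator, up to a constant factor. -/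
def dbar (f : ℂ → ℂ) (w : ℂ) : ℂ := Complex.I * fderiv ℝ f w 1 - fderiv ℝ f w Complex.I

lemma Filter.EventuallyEq.dbar_eq {f g : ℂ → ℂ} {w : ℂ} (h : f =ᶠ[nhds w] g) :
    dbar f w = dbar g w := by
  rw [dbar, dbar, h.fderiv_eq]

lemma dbar_mul {p q : ℂ → ℂ} {w : ℂ} (hp : DifferentiableAt ℂ p w) (hq : DifferentiableAt ℝ q w) :
    dbar (fun x => p x * q x) w = p w * dbar q w := by
  have h1 : HasFDerivAt p ((ContinuousLinearMap.toSpanSingleton ℂ (deriv p w)).restrictScalars ℝ) w :=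
    hp.hasDerivAt.hasFDerivAt.restrictScalars ℝ
  rw [dbar, (h1.fun_mul hq.hasFDerivAt).fderiv, dbar]
  simp
  ring

lemma dbar_eq_zero {p : ℂ → ℂ} {w : ℂ} (hp : DifferentiableAt ℂ p w) : dbar p w = 0 := by
  have := dbar_mul hp (differentiableAt_const (𝕜 := ℝ) (1 : ℂ))
  simpa [dbar] using this

lemma dbar_sub_const (q : ℂ → ℂ) (c w : ℂ) : dbar (fun x => q x - c) w = dbar q w := by
  simp [dbar, fderiv_sub_const]

lemma integral_eq_iterated_of_support_subset {G : ℂ → ℂ} (hG : Continuous G) {z w : ℂ}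
    (hs : ∀ x, G x ≠ 0 → x.re ∈ Ioc z.re w.re ∧ x.im ∈ Ioc z.im w.im) :
    ∫ x, G x = ∫ x : ℝ in z.re..w.re, ∫ y : ℝ in z.im..w.im, G (x + y * Complex.I) := by
  have hc : HasCompactSupport G := by
    refine HasCompactSupport.of_support_subset_isCompact
      ((isCompact_Icc (a := z.re) (b := w.re)).reProdIm (isCompact_Icc (a := z.im) (b := w.im))) ?_
    intro x hx
    have := hs x hx
    exact ⟨Ioc_subset_Icc_self this.1, Ioc_subset_Icc_self this.2⟩
  have hi : MeasureTheory.Integrable G := hG.integrable_of_hasCompactSupport hc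
  rw [← Complex.volume_preserving_equiv_real_prod.symm.integral_comp'
    (f := Complex.measurableEquivRealProd.symm)]
  rw [MeasureTheory.Measure.volume_eq_prod, MeasureTheory.integral_prod]
  · rw [intervalIntegral.integral_eq_integral_of_support_subset]
    · congr 1; ext x
      rw [intervalIntegral.integral_eq_integral_of_support_subset]
      · congr 1; ext y
        congr 1
        exact Complex.mk_eq_add_mul_I x y
      · intro y hy
        simpa using (hs _ hy).2
    · intro x hx
      by_contra hne
      apply hx
      have : ∀ y : ℝ, G (x + y * Complex.I) = 0 := fun y => by
        by_contra h
        exact hne (by simpa using (hs _ h).1)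
      simp [this]
  · exact Complex.volume_preserving_equiv_real_prod.symm.integrable_comp_of_integrable hi

/-- The (negative of the) winding integral of the boundary of the square of half-side `a`. -/
def squareConst (a : ℝ) : ℂ := -(Complex.I * ((4 * a * ∫ x : ℝ in -a..a, (x ^ 2 + a ^ 2)⁻¹ : ℝ) : ℂ))

lemma squareConst_ne_zero {a : ℝ} (ha : 0 < a) : squareConst a ≠ 0 := by
  rw [squareConst, neg_ne_zero]
  refine mul_ne_zero Complex.I_ne_zero ?_
  rw [Complex.ofReal_ne_zero]
  refine (mul_pos (by positivity) ?_).ne'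
  apply intervalIntegral.intervalIntegral_pos_of_pos
  · apply Continuous.intervalIntegrable
    exact Continuous.inv₀ (by fun_prop) fun x => by positivity
  · intro x; positivity
  · linarith

lemma ofReal_add_mul_I_ne_zero {x y : ℝ} (h : x ≠ 0 ∨ y ≠ 0) : (x + y * Complex.I : ℂ) ≠ 0 := by
  intro h0
  have h1 := congrArg Complex.re h0
  have h2 := congrArg Complex.im h0
  simp at h1 h2
  tauto

lemma square_boundary_inv {a : ℝ} (ha : 0 < a) :
    (∫ x : ℝ in -a..a, ((x + (-a : ℝ) * Complex.I : ℂ))⁻¹) - (∫ x : ℝ in -a..a, ((x + a * Complex.I : ℂ))⁻¹)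
      + Complex.I * (∫ y : ℝ in -a..a, ((a + y * Complex.I : ℂ))⁻¹)
      - Complex.I * (∫ y : ℝ in -a..a, (((-a : ℝ) + y * Complex.I : ℂ))⁻¹) = - squareConst a := by
  have hi : ∀ (f : ℝ → ℂ), Continuous f → (∀ x, f x ≠ 0) →
      IntervalIntegrable (fun x => (f x)⁻¹) MeasureTheory.volume (-a) a :=
    fun f hf h => (hf.inv₀ h).intervalIntegrable _ _
  have n1 : ∀ x : ℝ, (x + (-a : ℝ) * Complex.I : ℂ) ≠ 0 := fun x => ofReal_add_mul_I_ne_zero (.inr (by simpa using ha.ne'))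
  have n2 : ∀ x : ℝ, (x + a * Complex.I : ℂ) ≠ 0 := fun x => ofReal_add_mul_I_ne_zero (.inr ha.ne')
  have n3 : ∀ x : ℝ, (a + x * Complex.I : ℂ) ≠ 0 := fun x => ofReal_add_mul_I_ne_zero (.inl ha.ne')
  have n4 : ∀ x : ℝ, ((-a : ℝ) + x * Complex.I : ℂ) ≠ 0 := fun x => ofReal_add_mul_I_ne_zero (.inl (by simpa using ha.ne'))
  have i1 := hi _ (by fun_prop) n1
  have i2 := hi _ (by fun_prop) n2
  have i3 := (hi _ (by fun_prop) n3).const_mul Complex.I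
  have i4 := (hi _ (by fun_prop) n4).const_mul Complex.I
  rw [squareConst, neg_neg, ← intervalIntegral.integral_const_mul, ← intervalIntegral.integral_const_mul,
    ← intervalIntegral.integral_sub i1 i2, ← intervalIntegral.integral_add (i1.sub i2) i3,
    ← intervalIntegral.integral_sub ((i1.sub i2).add i3) i4,
    ← intervalIntegral.integral_const_mul, ← intervalIntegral.integral_ofReal,
    ← intervalIntegral.integral_const_mul]
  congr 1; ext x
  have n5 : ((x : ℂ) ^ 2 + a ^ 2) ≠ 0 := by
    have : x ^ 2 + a ^ 2 ≠ 0 := by positivity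
    exact_mod_cast this
  have e1 : (x + (-a : ℝ) * Complex.I : ℂ)⁻¹ = (x + a * Complex.I) / (x ^ 2 + a ^ 2) := by
    rw [inv_eq_iff_eq_inv, inv_div, eq_div_iff (n2 x)]
    push_cast
    linear_combination (-(a : ℂ) ^ 2) * Complex.I_sq
  have e2 : (x + a * Complex.I : ℂ)⁻¹ = (x - a * Complex.I) / (x ^ 2 + a ^ 2) := by
    have := n1 x
    rw [inv_eq_iff_eq_inv, inv_div, eq_div_iff (by push_cast at this; convert this using 1; ring)]
    linear_combination (-(a : ℂ) ^ 2) * Complex.I_sq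
  have e3 : (a + x * Complex.I : ℂ)⁻¹ = (a - x * Complex.I) / (x ^ 2 + a ^ 2) := by
    rw [inv_eq_iff_eq_inv, inv_div, eq_div_iff (by have := n4 x; push_cast at this; intro h; apply this; linear_combination -h)]
    linear_combination (-(x : ℂ) ^ 2) * Complex.I_sq
  have e4 : ((-a : ℝ) + x * Complex.I : ℂ)⁻¹ = (-a - x * Complex.I) / (x ^ 2 + a ^ 2) := by
    rw [inv_eq_iff_eq_inv, inv_div, eq_div_iff (by have := n3 x; intro h; apply this; linear_combination -h)]
    push_cast
    linear_combination (-(x : ℂ) ^ 2) * Complex.I_sq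
  rw [e1, e2, e3, e4]
  push_cast
  field_simp
  ring

/-- A form of the Cauchy–Pompeiu formula for compactly supported functions that are holomorphic
near the point of evaluation. -/
lemma integral_dbar_div {g : ℂ → ℂ} (hg : Differentiable ℝ g) {z : ℂ} {a : ℝ} (ha : 0 < a)
    (hgz : ∀ᶠ w in nhds z, DifferentiableAt ℂ g w)
    (hsupp : tsupport g ⊆ ball z a)
    (hc : Continuous fun w => dbar g w / (w - z)) :
    ∫ w, dbar g w / (w - z) = squareConst a * g z := by
  set f := dslope g z with hf
  have hfan : AnalyticAt ℂ f z := by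
    obtain ⟨O, hO, hOo, hzO⟩ := _root_.eventually_nhds_iff.1 hgz
    have : DifferentiableOn ℂ f O :=
      (Complex.differentiableOn_dslope (hOo.mem_nhds hzO)).2 fun w hw => (hO w hw).differentiableWithinAt
    exact this.analyticAt (hOo.mem_nhds hzO)
  have hfd : Differentiable ℝ f := by
    intro w
    by_cases h : w = z
    · subst h; exact hfan.differentiableAt.restrictScalars ℝ
    · have h1 : f =ᶠ[nhds w] fun x => (x - z)⁻¹ * (g x - g z) := by
        filter_upwards [isOpen_ne.mem_nhds h] with x hx
        rw [hf, dslope_of_ne _ hx, slope_def_field, div_eq_inv_mul]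
      refine DifferentiableAt.congr_of_eventuallyEq ?_ h1
      have h2 : DifferentiableAt ℂ (fun x => (x - z)⁻¹) w :=
        (differentiableAt_id.sub_const z).inv (sub_ne_zero.2 h)
      exact (h2.restrictScalars ℝ).mul ((hg w).sub_const _)
  have hdb : ∀ w, dbar f w = dbar g w / (w - z) := by
    intro w
    by_cases h : w = z
    · subst h; rw [dbar_eq_zero hfan.differentiableAt, sub_self, div_zero]
    · have h1 : f =ᶠ[nhds w] fun x => (x - z)⁻¹ * (g x - g z) := by
        filter_upwards [isOpen_ne.mem_nhds h] with x hx
        rw [hf, dslope_of_ne _ hx, slope_def_field, div_eq_inv_mul]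
      have h2 : DifferentiableAt ℂ (fun x => (x - z)⁻¹) w :=
        (differentiableAt_id.sub_const z).inv (sub_ne_zero.2 h)
      rw [h1.dbar_eq, dbar_mul h2 ((hg w).sub_const _), dbar_sub_const, div_eq_inv_mul]
  have hc' : Continuous (dbar f) := by simpa only [← hdb] using hc
  have key := Complex.integral_boundary_rect_of_hasFDerivAt_real_off_countable f (fderiv ℝ f)
    (z + (-a + (-a) * Complex.I)) (z + (a + a * Complex.I)) ∅ countable_empty
    hfd.continuous.continuousOn (fun x _ => (hfd x).hasFDerivAt)
    (hc'.continuousOn.integrableOn_compact (isCompact_uIcc.reProdIm isCompact_uIcc))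
  have hsupp' : ∀ x, dbar f x ≠ 0 → dist x z < a := by
    intro x hx
    by_contra h
    apply hx
    have h1 : g =ᶠ[nhds x] fun _ => 0 := by
      have := (isClosed_tsupport g).isOpen_compl.mem_nhds fun hx' => h (hsupp hx')
      filter_upwards [this] with y hy using image_eq_zero_of_notMem_tsupport hy
    rw [hdb, h1.dbar_eq, dbar_eq_zero (differentiableAt_const 0), zero_div]
  have key2 := integral_eq_iterated_of_support_subset hc'
    (z := z + (-a + (-a) * Complex.I)) (w := z + (a + a * Complex.I))
    (fun x hx => by
      have h1 := hsupp' x hx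
      rw [Complex.dist_eq] at h1
      have h2 := abs_lt.1 ((Complex.abs_re_le_norm _).trans_lt h1)
      have h3 := abs_lt.1 ((Complex.abs_im_le_norm _).trans_lt h1)
      simp at h2 h3 ⊢
      constructor <;> constructor <;> linarith)
  simp_rw [← hdb]
  rw [key2]
  refine key.symm.trans ?_
  have hbd : ∀ v : ℂ, a ≤ ‖v‖ → f (z + v) = -g z * v⁻¹ := by
    intro v hv
    have h0 : v ≠ 0 := fun h => by rw [h, norm_zero] at hv; linarith
    have h1 : g (z + v) = 0 := image_eq_zero_of_notMem_tsupport fun h => by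
      have := hsupp h
      rw [mem_ball, Complex.dist_eq, add_sub_cancel_left] at this
      linarith
    rw [hf, dslope_of_ne _ (by simpa using h0), slope_def_field, h1, add_sub_cancel_left]
    field_simp; ring
  have hre : ∀ x y : ℝ, |y| = a → a ≤ ‖(x + y * Complex.I : ℂ)‖ := fun x y h => by
    have := Complex.abs_im_le_norm (x + y * Complex.I)
    simp at this; linarith
  have him : ∀ x y : ℝ, |x| = a → a ≤ ‖(x + y * Complex.I : ℂ)‖ := fun x y h => by
    have := Complex.abs_re_le_norm (x + y * Complex.I)
    simp at this; linarith
  have haa : |a| = a := abs_of_pos ha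
  have hna : |(-a)| = a := by rw [abs_neg, haa]
  have j1 : ∀ y : ℝ, |y| = a → ∫ x : ℝ in (z.re + -a)..(z.re + a), f (x + (z.im + y : ℝ) * Complex.I) =
      -g z * ∫ x : ℝ in -a..a, (x + y * Complex.I : ℂ)⁻¹ := by
    intro y hy
    rw [← intervalIntegral.integral_comp_add_left
      (fun x : ℝ => f (x + (z.im + y : ℝ) * Complex.I)), ← intervalIntegral.integral_const_mul]
    congr 1; ext x
    rw [← hbd _ (hre x y hy)]
    congr 1
    apply Complex.ext <;> simp
  have j2 : ∀ x : ℝ, |x| = a → ∫ y : ℝ in (z.im + -a)..(z.im + a), f ((z.re + x : ℝ) + y * Complex.I) =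
      -g z * ∫ y : ℝ in -a..a, (x + y * Complex.I : ℂ)⁻¹ := by
    intro x hx
    rw [← intervalIntegral.integral_comp_add_left
      (fun y : ℝ => f ((z.re + x : ℝ) + y * Complex.I)), ← intervalIntegral.integral_const_mul]
    congr 1; ext y
    rw [← hbd _ (him x y hx)]
    congr 1
    apply Complex.ext <;> simp
  have r1 : (z + (-a + (-a) * Complex.I)).re = z.re + -a := by simp
  have r2 : (z + (-a + (-a) * Complex.I)).im = z.im + -a := by simp
  have r3 : (z + (a + a * Complex.I)).re = z.re + a := by simp
  have r4 : (z + (a + a * Complex.I)).im = z.im + a := by simp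
  rw [r1, r2, r3, r4, j1 _ haa, j1 _ hna, j2 _ haa, j2 _ hna, smul_eq_mul, smul_eq_mul,
    ← neg_eq_iff_eq_neg.2 (square_boundary_inv ha)]
  ring

lemma exists_complex_cutoff {S D : Set ℂ} (hS : IsCompact S) (hD : IsOpen D) (hSD : S ⊆ D) :
    ∃ χ : ℂ → ℂ, ContDiff ℝ 1 χ ∧ HasCompactSupport χ ∧ tsupport χ ⊆ D ∧
      ∀ z ∈ S, χ =ᶠ[nhds z] fun _ => 1 := by
  obtain ⟨L, hL, hSL, hLD⟩ := exists_compact_between hS hD hSD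
  obtain ⟨f, hf1, hf0, -⟩ := exists_contMDiffMap_one_nhds_of_subset_interior
    (n := 1) (modelWithCornersSelf ℝ ℂ) hS.isClosed hSL
  have hsupp : Function.support (fun z => (f z : ℂ)) ⊆ L := fun x hx => by
    by_contra h
    exact hx (by simp [hf0 x h])
  refine ⟨fun z => f z, Complex.ofRealCLM.contDiff.comp f.contMDiff.contDiff,
    HasCompactSupport.of_support_subset_isCompact hL hsupp,
    (closure_minimal hsupp hL.isClosed).trans hLD, fun z hz => ?_⟩
  filter_upwards [Filter.eventually_of_mem (nhds_le_nhdsSet hz hf1) fun x hx => hx] with x hx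
  have : f x = 1 := hx
  simp [this]

lemma continuous_dbar {χ : ℂ → ℂ} (h : ContDiff ℝ 1 χ) : Continuous (dbar χ) := by
  have := h.continuous_fderiv one_ne_zero
  unfold dbar
  fun_prop

/-- Holomorphic functional calculus in a commutative Banach algebra. -/
theorem exists_holomorphic_calculus {B : Type*} [NormedCommRing B] [NormedAlgebra ℂ B]
    [CompleteSpace B] (b : B) {D : Set ℂ} (hD : IsOpen D) (hb : spectrum ℂ b ⊆ D) {h : ℂ → ℂ}
    (hh : DifferentiableOn ℂ h D) :
    ∃ y : B, ∀ e : B →L[ℂ] ℂ, (∀ x y, e (x * y) = e x * e y) → e 1 = 1 → e y = h (e b) := by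
  obtain ⟨χ, hχ, hχc, hχD, hχ1⟩ := exists_complex_cutoff (spectrum.isCompact b) hD hb
  obtain ⟨ρ, hρ⟩ := hχc.isCompact.isBounded.subset_ball 0
  set a := 2 * max ρ 1 with ha
  have ha0 : 0 < a := by positivity
  have hoff : ∀ w ∉ tsupport χ, χ =ᶠ[nhds w] fun _ => 0 := fun w hw => by
    filter_upwards [(isClosed_tsupport χ).isOpen_compl.mem_nhds hw] with y hy
      using image_eq_zero_of_notMem_tsupport hy
  have hdoff : ∀ w ∉ tsupport χ, dbar χ w = 0 := fun w hw => by
    rw [(hoff w hw).dbar_eq, dbar_eq_zero (differentiableAt_const 0)]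
  have hdS : ∀ w ∈ spectrum ℂ b, dbar χ =ᶠ[nhds w] fun _ => 0 := fun w hw => by
    filter_upwards [(hχ1 w hw).eventuallyEq_nhds] with y hy
    rw [hy.dbar_eq, dbar_eq_zero (differentiableAt_const 1)]
  let g : ℂ → ℂ := fun w => h w * χ w
  have hgoff : ∀ w ∉ tsupport χ, g =ᶠ[nhds w] fun _ => 0 := fun w hw => by
    filter_upwards [hoff w hw] with y hy
    simp [g, hy]
  have hgd : Differentiable ℝ g := fun w => by
    by_cases hw : w ∈ tsupport χ
    · exact ((hh.differentiableAt (hD.mem_nhds (hχD hw))).restrictScalars ℝ).mul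
        (hχ.differentiable one_ne_zero w)
    · exact (differentiableAt_const 0).congr_of_eventuallyEq (hgoff w hw)
  have hgdbar : ∀ w, dbar g w = h w * dbar χ w := fun w => by
    by_cases hw : w ∈ tsupport χ
    · exact dbar_mul (hh.differentiableAt (hD.mem_nhds (hχD hw))) (hχ.differentiable one_ne_zero w)
    · rw [(hgoff w hw).dbar_eq, dbar_eq_zero (differentiableAt_const 0), hdoff w hw, mul_zero]
  have hgdc : Continuous (dbar g) := continuous_iff_continuousAt.2 fun w => by
    by_cases hw : w ∈ tsupport χ
    · have h1 : ContinuousAt (fun w => h w * dbar χ w) w :=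
        (hh.differentiableAt (hD.mem_nhds (hχD hw))).continuousAt.mul (continuous_dbar hχ).continuousAt
      exact h1.congr (Filter.Eventually.of_forall fun w => (hgdbar w).symm)
    · have : dbar g =ᶠ[nhds w] fun _ => 0 := by
        filter_upwards [(isClosed_tsupport χ).isOpen_compl.mem_nhds hw] with y hy
        rw [hgdbar, hdoff y hy, mul_zero]
      exact continuousAt_const.congr this.symm
  have hgS : ∀ w ∈ spectrum ℂ b, dbar g =ᶠ[nhds w] fun _ => 0 := fun w hw => by
    filter_upwards [hdS w hw] with y hy
    rw [hgdbar, hy, mul_zero]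
  let G : ℂ → B := fun w => dbar g w • resolvent b w
  have hGc : Continuous G := continuous_iff_continuousAt.2 fun w => by
    by_cases hw : w ∈ spectrum ℂ b
    · have : G =ᶠ[nhds w] fun _ => 0 := by
        filter_upwards [hgS w hw] with y hy
        simp [G, hy]
      exact continuousAt_const.congr this.symm
    · exact hgdc.continuousAt.smul
        (spectrum.hasDerivAt_resolvent_const_left (not_not.1 hw)).continuousAt
  have hGs : HasCompactSupport G := by
    refine HasCompactSupport.of_support_subset_isCompact hχc.isCompact fun w hw => ?_
    by_contra hc
    exact hw (by simp [G, hgdbar, hdoff w hc])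
  have hGi : MeasureTheory.Integrable G := hGc.integrable_of_hasCompactSupport hGs
  refine ⟨(squareConst a)⁻¹ • ∫ w, G w, fun e hmul hone => ?_⟩
  have hspec : e b ∈ spectrum ℂ b := by
    let e' : B →ₐ[ℂ] ℂ := AlgHom.ofLinearMap e.toLinearMap hone hmul
    exact AlgHom.apply_mem_spectrum e' b
  have heG : ∀ w, e (G w) = dbar g w / (w - e b) := fun w => by
    by_cases hw : w ∈ spectrum ℂ b
    · simp [G, (hgS w hw).self_of_nhds]
    · have h1 : resolvent b w * (algebraMap ℂ B w - b) = 1 :=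
        Ring.inverse_mul_cancel _ (not_not.1 hw)
      have h2 : e (resolvent b w) * (w - e b) = 1 := by
        rw [← hone, ← h1, hmul, map_sub, Algebra.algebraMap_eq_smul_one, map_smul, hone]
        simp
      simp only [G, map_smul, smul_eq_mul]
      rw [eq_div_iff (right_ne_zero_of_mul_eq_one h2), mul_assoc, h2, mul_one]
  have hχe : g (e b) = h (e b) := by simp [g, (hχ1 _ hspec).self_of_nhds]
  have hmem : e b ∈ tsupport χ := by
    apply subset_tsupport
    rw [Function.mem_support, (hχ1 _ hspec).self_of_nhds]
    exact one_ne_zero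
  have htg : tsupport g ⊆ tsupport χ := closure_mono fun w hw hw' => hw (by simp [g, hw'])
  have key := integral_dbar_div hgd (z := e b) ha0 ?_ ?_ ?_
  · rw [map_smul, ← ContinuousLinearMap.integral_comp_comm _ hGi]
    simp_rw [heG]
    rw [key, hχe, smul_eq_mul, inv_mul_cancel_left₀ (squareConst_ne_zero ha0)]
  · filter_upwards [(hχ1 _ hspec).eventuallyEq_nhds, hD.mem_nhds (hb hspec)] with w hw hwD
    refine (hh.differentiableAt (hD.mem_nhds hwD)).congr_of_eventuallyEq ?_
    filter_upwards [hw] with y hy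
    simp [g, hy]
  · intro w hw
    have h1 := hρ (htg hw)
    have h2 := hρ hmem
    rw [mem_ball_zero_iff] at h1 h2
    rw [mem_ball, dist_eq_norm]
    have := norm_sub_le w (e b)
    have := le_max_left ρ 1
    linarith
  · simp_rw [← heG]
    exact e.continuous.comp hGc

/-- Runge's theorem on an open set without holes. -/
theorem exists_polynomial_near {D : Set ℂ} (hD : IsOpen D)
    (hfill : ∀ O : Set ℂ, IsOpen O → Bornology.IsBounded O → frontier O ⊆ D → O ⊆ D)
    {h : ℂ → ℂ} (hh : DifferentiableOn ℂ h D) {K : Set ℂ} (hK : IsCompact K) (hKD : K ⊆ D)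
    {ε : ℝ} (hε : 0 < ε) : ∃ p : Polynomial ℂ, ∀ z ∈ K, ‖p.eval z - h z‖ < ε := by
  have : CompactSpace K := isCompact_iff_compactSpace.1 hK
  let X : C(K, ℂ) := ⟨Subtype.val, continuous_subtype_val⟩
  let S := Algebra.elemental ℂ X
  let b : S := ⟨X, Algebra.elemental.self_mem ℂ X⟩
  have hcl : IsClosed (S : Set C(K, ℂ)) := Algebra.elemental.isClosed ℂ X
  have : CompleteSpace S := hcl.completeSpace_coe
  have hfr : frontier (spectrum ℂ b) ⊆ D := by
    have := Subalgebra.frontier_spectrum S b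
    refine this.trans ?_
    rw [ContinuousMap.spectrum_eq_range]
    rintro _ ⟨x, rfl⟩
    exact hKD x.2
  have hspec : spectrum ℂ b ⊆ D := by
    have h1 : interior (spectrum ℂ b) ⊆ D := hfill _ isOpen_interior
      ((spectrum.isBounded b).subset interior_subset) ((frontier_interior_subset).trans hfr)
    intro x hx
    by_cases hxi : x ∈ interior (spectrum ℂ b)
    · exact h1 hxi
    · exact hfr ⟨subset_closure hx, hxi⟩
  obtain ⟨y, hy⟩ := exists_holomorphic_calculus (B := S) b hD hspec hh
  have hyz : ∀ z : K, (y : C(K, ℂ)) z = h z := fun z => by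
    have := hy ((ContinuousMap.evalCLM ℂ z).comp S.toSubmodule.subtypeL) (fun x y => rfl) rfl
    exact this
  have hmem : (y : C(K, ℂ)) ∈ closure ((Algebra.adjoin ℂ {X} : Subalgebra ℂ C(K, ℂ)) : Set C(K, ℂ)) := y.2
  obtain ⟨q, hq, hqd⟩ := Metric.mem_closure_iff.1 hmem ε hε
  rw [SetLike.mem_coe, Algebra.adjoin_singleton_eq_range_aeval] at hq
  obtain ⟨p, rfl⟩ := hq
  refine ⟨p, fun z hz => ?_⟩
  have h1 := (ContinuousMap.dist_apply_le_dist (⟨z, hz⟩ : K)).trans_lt hqd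
  rw [hyz, dist_comm, dist_eq_norm] at h1
  have : (ContinuousMap.evalAlgHom ℂ ℂ (⟨z, hz⟩ : K)) ((Polynomial.aeval X) p) = p.eval z := by
    rw [← Polynomial.aeval_algHom_apply]
    exact (Polynomial.coe_aeval_eq_eval z ▸ rfl)
  rw [← this]
  exact h1

lemma Polynomial.exists_derivative_eq (p : Polynomial ℂ) :
    ∃ P : Polynomial ℂ, Polynomial.derivative P = p ∧ P.eval 0 = 0 := by
  induction p using Polynomial.induction_on' with
  | add p q hp hq =>
    obtain ⟨P, hP, hP0⟩ := hp
    obtain ⟨Q, hQ, hQ0⟩ := hq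
    exact ⟨P + Q, by simp [hP, hQ], by simp [hP0, hQ0]⟩
  | monomial n a =>
    refine ⟨Polynomial.monomial (n + 1) (a / (n + 1)), ?_, by simp⟩
    rw [Polynomial.derivative_monomial]
    congr 1
    have : (n : ℂ) + 1 ≠ 0 := by exact_mod_cast n.succ_ne_zero
    push_cast; field_simp

namespace ExhaustedDomain

variable {D : Set ℂ} {V : ℕ → Set ℂ}

lemma isOpen_domain (hE : ExhaustedDomain D V) : IsOpen D :=
  hE.iUnion ▸ isOpen_iUnion hE.isOpen

lemma zero_mem_domain (hE : ExhaustedDomain D V) : (0 : ℂ) ∈ D :=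
  hE.iUnion ▸ mem_iUnion.2 ⟨0, hE.zero_mem 0⟩

lemma isPreconnected_domain (hE : ExhaustedDomain D V) : IsPreconnected D :=
  hE.iUnion ▸ isPreconnected_iUnion ⟨0, mem_iInter.2 hE.zero_mem⟩ hE.preconnected

theorem exists_primitive (hE : ExhaustedDomain D V) {h : ℂ → ℂ} (hh : DifferentiableOn ℂ h D) :
    ∃ H : ℂ → ℂ, ∀ z ∈ D, HasDerivAt H (h z) z := by
  have hcpt : ∀ n, IsCompact (closure (V n)) := fun n =>
    Metric.isCompact_of_isClosed_isBounded isClosed_closure (hE.bounded.subset (hE.closure_subset n))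
  choose p hp using fun n : ℕ => exists_polynomial_near hE.isOpen_domain hE.fill hh (hcpt n)
    (hE.closure_subset n) (ε := 1 / (n + 1)) (by positivity)
  choose P hP hP0 using fun n => (p n).exists_derivative_eq
  have hunif : ∀ j, TendstoUniformlyOn (fun n z => (p n).eval z) h Filter.atTop (V j) := by
    intro j
    rw [Metric.tendstoUniformlyOn_iff]
    intro ε hε
    obtain ⟨N, hN⟩ := exists_nat_one_div_lt hε
    filter_upwards [Filter.eventually_ge_atTop (max N j)] with n hn z hz
    rw [dist_comm, dist_eq_norm]
    refine (hp n z (subset_closure (hE.mono ((le_max_right _ _).trans hn) hz))).trans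
      (lt_of_le_of_lt ?_ hN)
    have : (N : ℝ) ≤ n := by exact_mod_cast (le_max_left _ _).trans hn
    gcongr
  have hderiv : ∀ n z, HasDerivAt (fun z => (P n).eval z) ((p n).eval z) z := fun n z => by
    simpa only [hP] using (P n).hasDerivAt z
  have hlim : ∀ z ∈ D, ∃ w, Filter.Tendsto (fun n => (P n).eval z) Filter.atTop (nhds w) := by
    intro z hz
    rw [← hE.iUnion, mem_iUnion] at hz
    obtain ⟨j, hj⟩ := hz
    have h1 : UniformCauchySeqOn (fun n z => (ContinuousLinearMap.smulRightL ℂ ℂ ℂ 1) ((p n).eval z))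
        Filter.atTop (V j) :=
      (ContinuousLinearMap.smulRightL ℂ ℂ ℂ 1).uniformContinuous.comp_uniformCauchySeqOn
        (hunif j).uniformCauchySeqOn
    have h2 := cauchy_map_of_uniformCauchySeqOn_fderiv (f := fun n z => (P n).eval z) (hE.isOpen j)
      (hE.preconnected j) h1 (fun n y _ => (hderiv n y).hasFDerivAt) (hE.zero_mem j) hj (by
        simp only [hP0]
        exact (tendsto_const_nhds (x := (0 : ℂ))).cauchy_map)
    exact cauchy_map_iff_exists_tendsto.1 h2
  choose! H hH using hlim
  refine ⟨H, fun z hz => ?_⟩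
  have hz' := hz
  rw [← hE.iUnion, mem_iUnion] at hz
  obtain ⟨j, hj⟩ := hz
  exact hasDerivAt_of_tendstoLocallyUniformlyOn (hE.isOpen j) (hunif j).tendstoLocallyUniformlyOn
    (Filter.Eventually.of_forall fun n x _ => hderiv n x)
    (fun x hx => hH x (hE.iUnion ▸ mem_iUnion.2 ⟨j, hx⟩)) hj

theorem exists_sqrt (hE : ExhaustedDomain D V) {f : ℂ → ℂ} (hf : DifferentiableOn ℂ f D)
    (hf0 : ∀ z ∈ D, f z ≠ 0) : ∃ g : ℂ → ℂ, DifferentiableOn ℂ g D ∧ ∀ z ∈ D, g z ^ 2 = f z := by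
  obtain ⟨L, hL⟩ := hE.exists_primitive
    (((hf.deriv hE.isOpen_domain).div hf hf0))
  have hd : ∀ z ∈ D, HasDerivAt f (deriv f z) z := fun z hz =>
    (hf.differentiableAt (hE.isOpen_domain.mem_nhds hz)).hasDerivAt
  have hconst : ∀ z ∈ D, HasDerivAt (fun z => f z * Complex.exp (-L z)) 0 z := fun z hz => by
    have h1 := (hd z hz).fun_mul (hL z hz).neg.cexp
    refine h1.congr_deriv ?_
    simp only [Pi.div_apply, Pi.neg_apply]
    have := hf0 z hz
    field_simp
    ring
  have heq : ∀ z ∈ D, f z * Complex.exp (-L z) = f 0 * Complex.exp (-L 0) := fun z hz =>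
    hE.isOpen_domain.is_const_of_deriv_eq_zero hE.isPreconnected_domain
      (fun z hz => (hconst z hz).differentiableAt.differentiableWithinAt)
      (fun z hz => (hconst z hz).deriv) hz hE.zero_mem_domain
  set c := f 0 * Complex.exp (-L 0) with hc
  have hc0 : c ≠ 0 := mul_ne_zero (hf0 0 hE.zero_mem_domain) (Complex.exp_ne_zero _)
  refine ⟨fun z => Complex.exp ((L z + Complex.log c) / 2), fun z hz => ?_, fun z hz => ?_⟩
  · exact ((hL z hz).differentiableAt.add_const _).div_const 2 |>.cexp.differentiableWithinAt
  · rw [← Complex.exp_nat_mul]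
    push_cast
    rw [mul_div_cancel₀ _ two_ne_zero, Complex.exp_add, Complex.exp_log hc0, ← heq z hz,
      Complex.exp_neg]
    field_simp [Complex.exp_ne_zero]

end ExhaustedDomain

/-- **Hurwitz's theorem** at a point: a locally uniform limit of zero-free holomorphic functions
has no isolated zero. -/
lemma TendstoLocallyUniformlyOn.ne_zero_of_not_eventually_eq_zero {ι : Type*} {l : Filter ι} [l.NeBot]
    {h : ι → ℂ → ℂ} {h₀ : ℂ → ℂ} {U : Set ℂ} {b : ℂ}
    (hlim : TendstoLocallyUniformlyOn h h₀ l U)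
    (hd : ∀ i, DifferentiableOn ℂ (h i) U) (hU : IsOpen U) (hb : b ∈ U)
    (hne : ∀ i, ∀ z ∈ U, h i z ≠ 0) (hnz : ¬ ∀ᶠ z in nhds b, h₀ z = 0) : h₀ b ≠ 0 := by
  intro hb0
  have hd0 : DifferentiableOn ℂ h₀ U := hlim.differentiableOn (Filter.Eventually.of_forall hd) hU
  have han : AnalyticAt ℂ h₀ b := hd0.analyticAt (hU.mem_nhds hb)
  have hiso := han.eventually_eq_zero_or_eventually_ne_zero.resolve_left hnz
  rw [eventually_nhdsWithin_iff] at hiso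
  obtain ⟨r, hr, hball⟩ := Metric.eventually_nhds_iff_ball.1 (hiso.and (hU.eventually_mem hb))
  have hcl : closedBall b (r / 2) ⊆ ball b r := closedBall_subset_ball (by linarith)
  have hclU : closedBall b (r / 2) ⊆ U := fun z hz => (hball z (hcl hz)).2
  have hcpt : IsCompact (closedBall b (r / 2)) := isCompact_closedBall _ _
  have hsph : IsCompact (sphere b (r / 2)) := isCompact_sphere _ _
  have hsn : (sphere b (r / 2)).Nonempty := NormedSpace.sphere_nonempty.2 (by linarith)
  obtain ⟨w, hw, hmin⟩ := hsph.exists_isMinOn hsn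
    ((hd0.continuousOn.mono (sphere_subset_closedBall.trans hclU)).norm)
  have hw0 : 0 < ‖h₀ w‖ := by
    rw [norm_pos_iff]
    refine (hball w (hcl (sphere_subset_closedBall hw))).1 ?_
    rintro rfl
    simp at hw
    linarith
  set m := ‖h₀ w‖
  have hu := (tendstoLocallyUniformlyOn_iff_forall_isCompact hU).1 hlim _ hclU hcpt
  rw [Metric.tendstoUniformlyOn_iff] at hu
  obtain ⟨i, hi⟩ := (hu (m / 3) (by linarith)).exists
  have hbb : b ∈ closedBall b (r / 2) := mem_closedBall_self (by linarith)
  have h1 : ‖h i b‖ < m / 3 := by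
    have := hi b hbb
    rwa [hb0, dist_zero_left] at this
  have h2 : ∀ z ∈ sphere b (r / 2), 2 * m / 3 ≤ ‖h i z‖ := by
    intro z hz
    have h3 := hi z (sphere_subset_closedBall hz)
    have h4 : m ≤ ‖h₀ z‖ := hmin hz
    rw [dist_eq_norm] at h3
    have := norm_sub_norm_le (h₀ z) (h i z)
    linarith
  have h5 : ‖(h i b)⁻¹‖ ≤ (2 * m / 3)⁻¹ := by
    refine Complex.norm_le_of_forall_mem_frontier_norm_le (U := ball b (r / 2))
      (f := fun z => (h i z)⁻¹) isBounded_ball ?_ ?_ (subset_closure (mem_ball_self (by linarith)))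
    · refine DifferentiableOn.diffContOnCl ?_
      rw [closure_ball _ (by linarith)]
      exact ((hd i).mono hclU).inv fun z hz => hne i z (hclU hz)
    · intro z hz
      rw [frontier_ball _ (by linarith)] at hz
      rw [norm_inv]
      exact inv_anti₀ (by linarith) (h2 z hz)
  rw [norm_inv] at h5
  have h6 : 0 < ‖h i b‖ := norm_pos_iff.2 (hne i b hb)
  have := (inv_le_inv₀ h6 (by linarith)).1 h5
  linarith

/-- A uniformly bounded family of holomorphic functions converges along any ultrafilter, locally
uniformly. -/
lemma Ultrafilter.exists_tendstoLocallyUniformlyOn {ι : Type*} (l : Ultrafilter ι)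
    {g : ι → ℂ → ℂ} {U : Set ℂ} (hU : IsOpen U) (hd : ∀ i, DifferentiableOn ℂ (g i) U)
    (hb : ∀ i, ∀ z ∈ U, ‖g i z‖ ≤ 1) :
    ∃ G : ℂ → ℂ, TendstoLocallyUniformlyOn g G (l : Filter ι) U := by
  have hpt : ∀ z : ℂ, ∃ w, z ∈ U → Filter.Tendsto (fun i => g i z) (l : Filter ι) (nhds w) := by
    intro z
    by_cases hz : z ∈ U
    · obtain ⟨w, -, hw⟩ := (isCompact_closedBall (0 : ℂ) 1).ultrafilter_le_nhds
        (l.map fun i => g i z) (by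
          rw [Ultrafilter.coe_map, Filter.le_principal_iff, Filter.mem_map]
          exact Filter.univ_mem' fun i => by simpa using hb i z hz)
      exact ⟨w, fun _ => hw⟩
    · exact ⟨0, fun h => (hz h).elim⟩
  choose G hG using hpt
  refine ⟨G, ?_⟩
  rw [Metric.tendstoLocallyUniformlyOn_iff]
  intro ε hε c hc
  obtain ⟨R, hR, hRU⟩ := Metric.isOpen_iff.1 hU c hc
  have hlip : ∀ i, ∀ z ∈ ball c R, dist (g i z) (g i c) ≤ 2 / R * dist z c := by
    intro i z hz
    refine Complex.dist_le_div_mul_dist_of_mapsTo_ball ((hd i).mono hRU) ?_ hz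
    intro y hy
    rw [mem_closedBall, dist_eq_norm]
    have := norm_sub_le (g i y) (g i c)
    have := hb i y (hRU hy)
    have := hb i c hc
    linarith
  have hlipG : ∀ z ∈ ball c R, dist (G z) (G c) ≤ 2 / R * dist z c := by
    intro z hz
    exact le_of_tendsto' ((hG z (hRU hz)).dist (hG c hc)) fun i => hlip i z hz
  set δ := min R (ε * R / 8)
  have hδ : 0 < δ := lt_min hR (by positivity)
  refine ⟨ball c δ, mem_nhdsWithin_of_mem_nhds (ball_mem_nhds c hδ), ?_⟩
  filter_upwards [Metric.tendsto_nhds.1 (hG c hc) (ε / 2) (by linarith)] with i hi z hz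
  have hzR : z ∈ ball c R := ball_subset_ball (min_le_left _ _) hz
  have hzd : dist z c < ε * R / 8 := (mem_ball.1 hz).trans_le (min_le_right _ _)
  have h1 : 2 / R * dist z c < ε / 4 := by
    calc 2 / R * dist z c < 2 / R * (ε * R / 8) := by gcongr
      _ = ε / 4 := by field_simp; norm_num
  have h2 := hlip i z hzR
  have h3 := hlipG z hzR
  have h4 := dist_triangle4 (G z) (G c) (g i c) (g i z)
  rw [dist_comm (G c), dist_comm (g i c) (g i z)] at h4
  linarith

/-- Injective holomorphic maps into the unit disc fixing the origin. -/
structure IsNormalizedEmbedding (D : Set ℂ) (g : ℂ → ℂ) : Prop where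
  differentiableOn : DifferentiableOn ℂ g D
  injOn : InjOn g D
  deriv_ne_zero : ∀ z ∈ D, deriv g z ≠ 0
  map_zero : g 0 = 0
  norm_lt_one : ∀ z ∈ D, ‖g z‖ < 1

/-- A normalized embedding with maximal derivative at the origin exists. -/
theorem exists_extremal_isNormalizedEmbedding {D : Set ℂ} (hD : IsOpen D) (hpc : IsPreconnected D)
    (hbd : Bornology.IsBounded D) (h0 : (0 : ℂ) ∈ D) :
    ∃ G, IsNormalizedEmbedding D G ∧
      ∀ g, IsNormalizedEmbedding D g → ‖deriv g 0‖ ≤ ‖deriv G 0‖ := by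
  obtain ⟨R, hR, hDR⟩ := hbd.subset_ball_lt 0 0
  have hbase : IsNormalizedEmbedding D (fun z => z / R) := by
    have hRc : (R : ℂ) ≠ 0 := by exact_mod_cast hR.ne'
    refine ⟨(differentiable_id.div_const _).differentiableOn, ?_, ?_, by simp, ?_⟩
    · intro a _ b _ hab
      simpa [div_left_inj' hRc] using hab
    · intro z _
      simp [hR.ne']
    · intro z hz
      have := hDR hz
      rw [mem_ball_zero_iff] at this
      rw [norm_div, Complex.norm_real, Real.norm_of_nonneg hR.le, div_lt_one hR]
      exact this
  obtain ⟨ρ, hρ, hρD⟩ := Metric.isOpen_iff.1 hD 0 h0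
  set S : Set ℝ := {x | ∃ g, IsNormalizedEmbedding D g ∧ ‖deriv g 0‖ = x}
  have hSne : S.Nonempty := ⟨_, _, hbase, rfl⟩
  have hSb : BddAbove S := by
    refine ⟨1 / ρ, ?_⟩
    rintro _ ⟨g, hg, rfl⟩
    refine Complex.norm_deriv_le_div_of_mapsTo_ball (hg.differentiableOn.mono hρD) ?_ hρ
    intro z hz
    rw [hg.map_zero, mem_closedBall_zero_iff]
    exact (hg.norm_lt_one z (hρD hz)).le
  obtain ⟨x, -, hx, hxS⟩ := exists_seq_tendsto_sSup hSne hSb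
  choose g hg hgx using hxS
  set l : Ultrafilter ℕ := Filter.hyperfilter ℕ
  have hl : (l : Filter ℕ) ≤ Filter.atTop := Nat.hyperfilter_le_atTop
  obtain ⟨G, hG⟩ := l.exists_tendstoLocallyUniformlyOn hD (fun i => (hg i).differentiableOn)
    fun i z hz => ((hg i).norm_lt_one z hz).le
  have hev : ∀ᶠ n in (l : Filter ℕ), DifferentiableOn ℂ (g n) D :=
    Filter.Eventually.of_forall fun i => (hg i).differentiableOn
  have hGd : DifferentiableOn ℂ G D := hG.differentiableOn hev hD
  have hGd' := hG.deriv hev hD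
  have hder : ‖deriv G 0‖ = sSup S := by
    refine tendsto_nhds_unique (hGd'.tendsto_at h0).norm ?_
    simpa only [Function.comp_apply, hgx] using hx.mono_left hl
  have hmax : ∀ f, IsNormalizedEmbedding D f → ‖deriv f 0‖ ≤ ‖deriv G 0‖ := fun f hf => by
    rw [hder]
    exact le_csSup hSb ⟨f, hf, rfl⟩
  have hpos : deriv G 0 ≠ 0 := by
    have := hmax _ hbase
    rw [← norm_pos_iff]
    exact (norm_pos_iff.2 (hbase.deriv_ne_zero 0 h0)).trans_le this
  have hGan : AnalyticOnNhd ℂ G D := hGd.analyticOnNhd hD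
  have hnc : ∀ b ∈ D, ∀ c, ¬ ∀ᶠ z in nhds b, G z = c := by
    intro b hb c hc
    have h1 : EqOn G (fun _ => c) D :=
      hGan.eqOn_of_preconnected_of_eventuallyEq analyticOnNhd_const hpc hb hc
    have h2 : G =ᶠ[nhds 0] fun _ => c := Filter.eventuallyEq_of_mem (hD.mem_nhds h0) h1
    exact hpos (by rw [h2.deriv_eq, deriv_const])
  have hle : ∀ z ∈ D, ‖G z‖ ≤ 1 := fun z hz =>
    le_of_tendsto' (hG.tendsto_at hz).norm fun i => ((hg i).norm_lt_one z hz).le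
  refine ⟨G, ⟨hGd, ?_, ?_, ?_, ?_⟩, hmax⟩
  · intro a ha b hb hab
    by_contra hne
    have hU : IsOpen (D \ {a}) := hD.sdiff isClosed_singleton
    have hlim : TendstoLocallyUniformlyOn (fun n z => g n z - g n a) (fun z => G z - G a)
        (l : Filter ℕ) (D \ {a}) := by
      have h1 := (hG.mono (sdiff_subset : D \ {a} ⊆ D))
      have h2 : TendstoLocallyUniformlyOn (fun n (_ : ℂ) => g n a) (fun _ => G a)
          (l : Filter ℕ) (D \ {a}) := by
        rw [Metric.tendstoLocallyUniformlyOn_iff]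
        intro ε hε c _
        refine ⟨univ, Filter.univ_mem, ?_⟩
        filter_upwards [Metric.tendsto_nhds.1 (hG.tendsto_at ha) ε hε] with i hi z _
        rwa [dist_comm]
      exact h1.sub h2
    refine hlim.ne_zero_of_not_eventually_eq_zero (b := b) (fun i => ?_) hU ⟨hb, fun h => hne h.symm⟩
      ?_ ?_ (sub_eq_zero.2 hab.symm)
    · exact ((hg i).differentiableOn.mono sdiff_subset).sub_const _
    · intro i z hz h
      exact hz.2 ((hg i).injOn hz.1 ha (sub_eq_zero.1 h))
    · intro h
      exact hnc b hb (G a) (h.mono fun z hz => sub_eq_zero.1 hz)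
  · intro b hb
    refine hGd'.ne_zero_of_not_eventually_eq_zero (fun i => ?_) hD hb
      (fun i z hz => (hg i).deriv_ne_zero z hz) ?_
    · exact (hg i).differentiableOn.deriv hD
    · intro h
      have h1 : EqOn (deriv G) (fun _ => 0) D :=
        (hGd.deriv hD).analyticOnNhd hD |>.eqOn_of_preconnected_of_eventuallyEq
          analyticOnNhd_const hpc hb h
      exact hpos (h1 h0)
  · refine tendsto_nhds_unique (hG.tendsto_at h0) ?_
    simp only [(hg _).map_zero]
    exact tendsto_const_nhds
  · intro z hz
    refine lt_of_le_of_ne (hle z hz) fun h => ?_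
    have h1 : EqOn G (Function.const ℂ (G z)) D :=
      Complex.eqOn_of_isPreconnected_of_isMaxOn_norm hpc hD hGd hz fun w hw => by
        simpa [h] using hle w hw
    exact hnc z hz (G z) (Filter.eventually_of_mem (hD.mem_nhds hz) h1)

/-- The automorphism of the unit disc that sends `w` to `0`. -/
def discAut (w ζ : ℂ) : ℂ := (ζ - w) / (1 - (starRingEnd ℂ) w * ζ)

lemma one_sub_conj_mul_ne_zero {w ζ : ℂ} (hw : ‖w‖ < 1) (hζ : ‖ζ‖ < 1) :
    1 - (starRingEnd ℂ) w * ζ ≠ 0 := by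
  intro h
  have h1 : ‖(starRingEnd ℂ) w * ζ‖ = 1 := by rw [← sub_eq_zero.1 h, norm_one]
  rw [norm_mul, RCLike.norm_conj] at h1
  nlinarith [norm_nonneg w, norm_nonneg ζ]

lemma norm_discAut_lt_one {w ζ : ℂ} (hw : ‖w‖ < 1) (hζ : ‖ζ‖ < 1) : ‖discAut w ζ‖ < 1 := by
  rw [discAut, norm_div, div_lt_one (norm_pos_iff.2 (one_sub_conj_mul_ne_zero hw hζ)),
    ← sq_lt_sq₀ (norm_nonneg _) (norm_nonneg _)]
  have h1 : ‖w‖ ^ 2 < 1 := by nlinarith [norm_nonneg w]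
  have h2 : ‖ζ‖ ^ 2 < 1 := by nlinarith [norm_nonneg ζ]
  rw [← Complex.normSq_eq_norm_sq] at h1 h2 ⊢
  rw [← Complex.normSq_eq_norm_sq]
  simp only [Complex.normSq_apply, Complex.sub_re, Complex.sub_im, Complex.mul_re, Complex.mul_im,
    Complex.conj_re, Complex.conj_im, Complex.one_re, Complex.one_im] at *
  nlinarith [mul_pos (sub_pos.2 h1) (sub_pos.2 h2)]

lemma one_sub_conj_mul_self_ne_zero {w : ℂ} (hw : ‖w‖ < 1) : 1 - (starRingEnd ℂ) w * w ≠ 0 :=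
  one_sub_conj_mul_ne_zero hw hw

lemma discAut_injOn {w ζ ξ : ℂ} (hw : ‖w‖ < 1) (hζ : ‖ζ‖ < 1) (hξ : ‖ξ‖ < 1)
    (h : discAut w ζ = discAut w ξ) : ζ = ξ := by
  rw [discAut, discAut, div_eq_div_iff (one_sub_conj_mul_ne_zero hw hζ)
    (one_sub_conj_mul_ne_zero hw hξ)] at h
  have h1 : (1 - (starRingEnd ℂ) w * w) * (ζ - ξ) = 0 := by linear_combination h
  exact sub_eq_zero.1 ((mul_eq_zero.1 h1).resolve_left (one_sub_conj_mul_self_ne_zero hw))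

lemma hasDerivAt_discAut {w ζ : ℂ} (hw : ‖w‖ < 1) (hζ : ‖ζ‖ < 1) :
    HasDerivAt (discAut w)
      ((1 - (starRingEnd ℂ) w * w) / (1 - (starRingEnd ℂ) w * ζ) ^ 2) ζ := by
  have h0 := one_sub_conj_mul_ne_zero hw hζ
  have h1 := ((hasDerivAt_id ζ).sub_const w).fun_div
    (((hasDerivAt_id ζ).const_mul ((starRingEnd ℂ) w)).const_sub 1) h0
  refine h1.congr_deriv ?_
  simp only [id]
  field_simp
  ring

/-- If a normalized embedding `G` omits a value of the disc, its derivative at the origin is not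
maximal (Koebe's square root trick). -/
theorem IsNormalizedEmbedding.surjOn_of_extremal {D : Set ℂ} {G : ℂ → ℂ} (hD : IsOpen D)
    (h0 : (0 : ℂ) ∈ D)
    (hsqrt : ∀ f : ℂ → ℂ, DifferentiableOn ℂ f D → (∀ z ∈ D, f z ≠ 0) →
      ∃ g, DifferentiableOn ℂ g D ∧ ∀ z ∈ D, g z ^ 2 = f z)
    (hG : IsNormalizedEmbedding D G)
    (hmax : ∀ g, IsNormalizedEmbedding D g → ‖deriv g 0‖ ≤ ‖deriv G 0‖) :
    ∀ w : ℂ, ‖w‖ < 1 → ∃ z ∈ D, G z = w := by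
  intro w hw
  by_contra! hno
  have hGd : ∀ z ∈ D, HasDerivAt G (deriv G z) z := fun z hz =>
    (hG.differentiableOn.differentiableAt (hD.mem_nhds hz)).hasDerivAt
  have hmd : ∀ z ∈ D, HasDerivAt (fun z => discAut w (G z))
      ((1 - (starRingEnd ℂ) w * w) / (1 - (starRingEnd ℂ) w * G z) ^ 2 * deriv G z) z :=
    fun z hz => (hasDerivAt_discAut hw (hG.norm_lt_one z hz)).comp z (hGd z hz)
  obtain ⟨s, hs, hs2⟩ := hsqrt (fun z => discAut w (G z))
    (fun z hz => (hmd z hz).differentiableAt.differentiableWithinAt) (fun z hz => by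
      rw [discAut]
      exact div_ne_zero (sub_ne_zero.2 (hno z hz))
        (one_sub_conj_mul_ne_zero hw (hG.norm_lt_one z hz)))
  have hsn : ∀ z ∈ D, ‖s z‖ < 1 := by
    intro z hz
    have h1 := norm_discAut_lt_one hw (hG.norm_lt_one z hz)
    rw [← hs2 z hz, norm_pow] at h1
    nlinarith [norm_nonneg (s z)]
  have hsd : ∀ z ∈ D, HasDerivAt s (deriv s z) z := fun z hz =>
    (hs.differentiableAt (hD.mem_nhds hz)).hasDerivAt
  have hsd2 : ∀ z ∈ D, 2 * s z * deriv s z =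
      (1 - (starRingEnd ℂ) w * w) / (1 - (starRingEnd ℂ) w * G z) ^ 2 * deriv G z := by
    intro z hz
    have h1 : HasDerivAt (fun z => s z ^ 2) (2 * s z * deriv s z) z := by
      simpa using (hsd z hz).fun_pow 2
    refine h1.unique ((hmd z hz).congr_of_eventuallyEq ?_)
    exact Filter.eventuallyEq_of_mem (hD.mem_nhds hz) hs2
  have hsne : ∀ z ∈ D, deriv s z ≠ 0 := by
    intro z hz h
    have h1 := hsd2 z hz
    rw [h, mul_zero] at h1
    exact mul_ne_zero (div_ne_zero (one_sub_conj_mul_self_ne_zero hw)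
      (pow_ne_zero 2 (one_sub_conj_mul_ne_zero hw (hG.norm_lt_one z hz))))
      (hG.deriv_ne_zero z hz) h1.symm
  set a := s 0
  have ha1 : ‖a‖ < 1 := hsn 0 h0
  have ha2 : a ^ 2 = -w := by
    have := hs2 0 h0
    simpa [hG.map_zero, discAut] using this
  have hw0 : 0 < ‖w‖ := by
    rw [norm_pos_iff]
    rintro rfl
    exact hno 0 h0 hG.map_zero
  have hTd : ∀ z ∈ D, HasDerivAt (fun z => discAut a (s z))
      ((1 - (starRingEnd ℂ) a * a) / (1 - (starRingEnd ℂ) a * s z) ^ 2 * deriv s z) z :=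
    fun z hz => (hasDerivAt_discAut ha1 (hsn z hz)).comp z (hsd z hz)
  have hT : IsNormalizedEmbedding D (fun z => discAut a (s z)) := by
    refine ⟨fun z hz => (hTd z hz).differentiableAt.differentiableWithinAt, ?_, ?_, ?_, ?_⟩
    · intro x hx y hy hxy
      have h1 : s x = s y := discAut_injOn ha1 (hsn x hx) (hsn y hy) hxy
      refine hG.injOn hx hy (discAut_injOn hw (hG.norm_lt_one x hx) (hG.norm_lt_one y hy) ?_)
      rw [← hs2 x hx, ← hs2 y hy, h1]
    · intro z hz
      rw [(hTd z hz).deriv]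
      exact mul_ne_zero (div_ne_zero (one_sub_conj_mul_self_ne_zero ha1)
        (pow_ne_zero 2 (one_sub_conj_mul_ne_zero ha1 (hsn z hz)))) (hsne z hz)
    · simp [discAut, a]
    · exact fun z hz => norm_discAut_lt_one ha1 (hsn z hz)
  have hle := hmax _ hT
  have hpos : 0 < ‖deriv G 0‖ := norm_pos_iff.2 (hG.deriv_ne_zero 0 h0)
  have hone : ∀ x : ℂ, ‖x‖ < 1 → ‖1 - (starRingEnd ℂ) x * x‖ = 1 - ‖x‖ ^ 2 := by
    intro x hx
    have h1 : 1 - (starRingEnd ℂ) x * x = ((1 - ‖x‖ ^ 2 : ℝ) : ℂ) := by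
      rw [mul_comm, Complex.mul_conj, Complex.normSq_eq_norm_sq]
      push_cast
      rfl
    rw [h1, Complex.norm_real, Real.norm_of_nonneg]
    nlinarith [norm_nonneg x]
  have haw : ‖a‖ ^ 2 = ‖w‖ := by rw [← norm_pow, ha2, norm_neg]
  have ha0 : 0 < ‖a‖ := by
    rcases (norm_nonneg a).eq_or_lt with h | h
    · rw [← h] at haw
      norm_num at haw
      exact absurd haw.symm hw0.ne'
    · exact h
  have hderivT : (1 - ‖a‖ ^ 2) * ‖deriv (fun z => discAut a (s z)) 0‖ = ‖deriv s 0‖ := by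
    rw [(hTd 0 h0).deriv, norm_mul, norm_div, norm_pow, hone a ha1]
    have : 1 - ‖a‖ ^ 2 ≠ 0 := by nlinarith
    field_simp
  have hderivs : 2 * ‖a‖ * ‖deriv s 0‖ = (1 - ‖w‖ ^ 2) * ‖deriv G 0‖ := by
    have h1 := congrArg norm (hsd2 0 h0)
    rw [norm_mul, norm_mul, norm_mul, norm_div, hone w hw, hG.map_zero] at h1
    simpa using h1
  rw [← haw] at hderivs
  have h3 : 0 < 1 - ‖a‖ ^ 2 := by nlinarith
  have h4 : 2 * ‖a‖ * ‖deriv (fun z => discAut a (s z)) 0‖ = (1 + ‖a‖ ^ 2) * ‖deriv G 0‖ := by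
    apply mul_left_cancel₀ h3.ne'
    rw [← hderivT] at hderivs
    linear_combination hderivs
  have h5 : 0 < (1 - ‖a‖) ^ 2 * ‖deriv G 0‖ := by
    have : 0 < 1 - ‖a‖ := by linarith
    positivity
  nlinarith [mul_le_mul_of_nonneg_left hle ha0.le]

/-- **Riemann mapping theorem**, for bounded domains on which zero-free holomorphic functions have
square roots. -/
theorem exists_biholomorphic_unitDisc {D : Set ℂ} (hD : IsOpen D) (hpc : IsPreconnected D)
    (hbd : Bornology.IsBounded D) (h0 : (0 : ℂ) ∈ D)
    (hsqrt : ∀ f : ℂ → ℂ, DifferentiableOn ℂ f D → (∀ z ∈ D, f z ≠ 0) →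
      ∃ g, DifferentiableOn ℂ g D ∧ ∀ z ∈ D, g z ^ 2 = f z) :
    ∃ ψ G : ℂ → ℂ, DifferentiableOn ℂ ψ (ball 0 1) ∧ ContinuousOn G D ∧
      MapsTo ψ (ball 0 1) D ∧ MapsTo G D (ball 0 1) ∧
      (∀ ζ ∈ ball (0 : ℂ) 1, G (ψ ζ) = ζ) ∧ (∀ z ∈ D, ψ (G z) = z) ∧
      ∀ ζ ∈ ball (0 : ℂ) 1, deriv ψ ζ ≠ 0 := by
  obtain ⟨G, hG, hmax⟩ := exists_extremal_isNormalizedEmbedding hD hpc hbd h0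
  have hsurj := hG.surjOn_of_extremal hD h0 hsqrt hmax
  choose! ψ hψD hGψ using hsurj
  have hψG : ∀ z ∈ D, ψ (G z) = z := fun z hz =>
    hG.injOn (hψD _ (hG.norm_lt_one z hz)) hz (hGψ _ (hG.norm_lt_one z hz))
  have hder : ∀ ζ ∈ ball (0 : ℂ) 1, HasDerivAt ψ (deriv G (ψ ζ))⁻¹ ζ := by
    intro ζ hζ
    have hζ' : ‖ζ‖ < 1 := mem_ball_zero_iff.1 hζ
    have hst : HasStrictDerivAt G (deriv G (ψ ζ)) (ψ ζ) :=
      (hG.differentiableOn.analyticAt (hD.mem_nhds (hψD ζ hζ'))).hasStrictDerivAt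
    have hne := hG.deriv_ne_zero _ (hψD ζ hζ')
    have hcont : ContinuousAt ψ ζ := by
      have h1 := hst.map_nhds_eq hne
      rw [hGψ ζ hζ'] at h1
      rw [ContinuousAt, ← h1, Filter.tendsto_map'_iff]
      refine Filter.Tendsto.congr' ?_ Filter.tendsto_id
      exact Filter.eventually_of_mem (hD.mem_nhds (hψD ζ hζ')) fun z hz => (hψG z hz).symm
    exact HasDerivAt.of_local_left_inverse hcont hst.hasDerivAt hne
      (Filter.eventually_of_mem (isOpen_ball.mem_nhds hζ) fun y hy =>
        hGψ y (mem_ball_zero_iff.1 hy))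
  refine ⟨ψ, G, fun ζ hζ => (hder ζ hζ).differentiableAt.differentiableWithinAt,
    hG.differentiableOn.continuousOn, fun ζ hζ => hψD ζ (mem_ball_zero_iff.1 hζ),
    fun z hz => mem_ball_zero_iff.2 (hG.norm_lt_one z hz),
    fun ζ hζ => hGψ ζ (mem_ball_zero_iff.1 hζ), hψG, fun ζ hζ => ?_⟩
  rw [(hder ζ hζ).deriv]
  exact inv_ne_zero (hG.deriv_ne_zero _ (hψD ζ (mem_ball_zero_iff.1 hζ)))

/-- There is a wall sequence in `ℂ²` such that any path in the ball that tends to the sphere and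
avoids all walls has infinite length. -/
theorem exists_isWallSequence_forall_eVariationOn_eq_top :
    ∃ (u : ℕ → H2) (σ η s : ℕ → ℝ) (T : ℕ → Set H2), IsWallSequence u σ η s T ∧
      ∀ c : ℝ → H2, ContinuousOn c (Ico 0 1) → (∀ t ∈ Ico (0 : ℝ) 1, ‖c t‖ < 1) →
        (∀ r < 1, ∃ t₀ ∈ Ico (0 : ℝ) 1, ∀ t ∈ Ico t₀ 1, r < ‖c t‖) →
        (∀ t ∈ Ico (0 : ℝ) 1, ∀ k, c t ∉ T k) → eVariationOn c (Ico 0 1) = ⊤ := by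
  let _ : InnerProductSpace ℝ H2 := InnerProductSpace.complexToReal
  have : FiniteDimensional ℝ H2 := FiniteDimensional.complexToReal H2
  obtain ⟨u, σ, η, s, T, h1, h2, h3, h4, h5, h6, h7, h8, h9, h10⟩ := exists_labyrinth H2
  refine ⟨u, σ, η, s, T, ⟨h1, h2, h3, h4, h5, h6, h7, h8, h9⟩, h10⟩

/-- Alarcón–Globevnik–López: a complete proper holomorphic embedding of the disc into the
unit ball 𝔹₂ of ℂ². -/
theorem complete_proper_embedded_disc_B2 :
    ∃ φ : ℂ → EuclideanSpace ℂ (Fin 2),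
      DifferentiableOn ℂ φ (Metric.ball (0 : ℂ) 1) ∧
      Set.InjOn φ (Metric.ball (0 : ℂ) 1) ∧
      (∀ ζ ∈ Metric.ball (0 : ℂ) 1, deriv φ ζ ≠ 0) ∧
      (∀ ζ ∈ Metric.ball (0 : ℂ) 1, φ ζ ∈ Metric.ball (0 : EuclideanSpace ℂ (Fin 2)) 1) ∧
      (∀ K : Set (EuclideanSpace ℂ (Fin 2)),
        K ⊆ Metric.ball (0 : EuclideanSpace ℂ (Fin 2)) 1 → IsCompact K →
        IsCompact {ζ ∈ Metric.ball (0 : ℂ) 1 | φ ζ ∈ K}) ∧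
      (∀ γ : ℝ → ℂ, DivergentPathIn (Metric.ball (0 : ℂ) 1) γ →
        eVariationOn (fun t => φ (γ t)) (Set.Ico 0 1) = ⊤) := by
  obtain ⟨u, σ, η, s, T, hw, hlen⟩ := exists_isWallSequence_forall_eVariationOn_eq_top
  obtain ⟨D, V, F, hE, hFd, hFinj, hFder, hFlt, hFcpt, hFT⟩ := hw.exists_embedded_domain
  have hD := hE.isOpen_domain
  obtain ⟨ψ, G, hψd, hGc, hψm, hGm, hGψ, hψG, hψder⟩ := exists_biholomorphic_unitDisc hD
    hE.isPreconnected_domain hE.bounded hE.zero_mem_domain fun f hf hf0 => hE.exists_sqrt hf hf0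
  have hφd : DifferentiableOn ℂ (fun ζ => F (ψ ζ)) (ball 0 1) := hFd.comp hψd hψm
  have hsub : ∀ r < 1, IsCompact {ζ ∈ ball (0 : ℂ) 1 | ‖F (ψ ζ)‖ ≤ r} := by
    intro r hr
    have h1 : {ζ ∈ ball (0 : ℂ) 1 | ‖F (ψ ζ)‖ ≤ r} = G '' {z ∈ D | ‖F z‖ ≤ r} := by
      ext ζ
      constructor
      · rintro ⟨h1, h2⟩
        exact ⟨ψ ζ, ⟨hψm h1, h2⟩, hGψ ζ h1⟩
      · rintro ⟨z, ⟨h1, h2⟩, rfl⟩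
        exact ⟨hGm h1, by simpa only [hψG z h1] using h2⟩
    rw [h1]
    exact (hFcpt r hr).image_of_continuousOn (hGc.mono fun z hz => hz.1)
  refine ⟨fun ζ => F (ψ ζ), hφd, ?_, ?_, ?_, ?_, ?_⟩
  · intro a ha b hb hab
    rw [← hGψ a ha, ← hGψ b hb, hFinj (hψm ha) (hψm hb) hab]
  · intro ζ hζ
    have h1 : HasDerivAt F (deriv F (ψ ζ)) (ψ ζ) :=
      (hFd.differentiableAt (hD.mem_nhds (hψm hζ))).hasDerivAt
    have h2 : HasDerivAt ψ (deriv ψ ζ) ζ :=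
      (hψd.differentiableAt (isOpen_ball.mem_nhds hζ)).hasDerivAt
    have h3 : HasDerivAt (fun ζ => F (ψ ζ)) (deriv ψ ζ • deriv F (ψ ζ)) ζ :=
      HasDerivAt.scomp ζ h1 h2
    rw [h3.deriv]
    exact smul_ne_zero (hψder ζ hζ) (hFder _ (hψm hζ))
  · exact fun ζ hζ => mem_ball_zero_iff.2 (hFlt _ (hψm hζ))
  · intro K hK hKc
    obtain ⟨r, hr, hKr⟩ : ∃ r < 1, ∀ x ∈ K, ‖x‖ ≤ r := by
      rcases K.eq_empty_or_nonempty with rfl | hne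
      · exact ⟨0, one_pos, fun x hx => hx.elim⟩
      · obtain ⟨x, hx, hmax⟩ := hKc.exists_isMaxOn hne continuous_norm.continuousOn
        exact ⟨‖x‖, mem_ball_zero_iff.1 (hK hx), fun y hy => hmax hy⟩
    have hset : {ζ ∈ ball (0 : ℂ) 1 | F (ψ ζ) ∈ K} =
        {ζ ∈ ball (0 : ℂ) 1 | ‖F (ψ ζ)‖ ≤ r} ∩ (fun ζ => F (ψ ζ)) ⁻¹' K := by
      ext ζ
      exact ⟨fun h => ⟨⟨h.1, hKr _ h.2⟩, h.2⟩, fun h => ⟨h.1.1, h.2⟩⟩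
    rw [hset]
    refine (hsub r hr).of_isClosed_subset ?_ inter_subset_left
    exact (hφd.continuousOn.mono fun ζ hζ => hζ.1).preimage_isClosed_of_isClosed
      (hsub r hr).isClosed hKc.isClosed
  · rintro γ ⟨hγc, hγm, hγdiv⟩
    refine hlen _ (hφd.continuousOn.comp hγc hγm) (fun t ht => hFlt _ (hψm (hγm t ht)))
      (fun r hr => ?_) (fun t ht k => hFT _ (hψm (hγm t ht)) k)
    obtain ⟨t₀, ht₀, h⟩ := hγdiv _ (fun ζ hζ => hζ.1) (hsub r hr)
    refine ⟨t₀, ht₀, fun t ht => ?_⟩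
    by_contra! hle
    exact h t ht ⟨hγm t ⟨ht₀.1.trans ht.1, ht.2⟩, hle⟩
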